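/- arXiv:2303.14855 — 2 statements merged into one kernel-verified Lean document; each statement's English description precedes it below -/
import Mathlib

section
/- Let T be an ω-Calderón–Zygmund operator with ω satisfying the Dini condition. (i) For all 1<p,q<∞, μ ∈ A_p, λ ∈ A_q and b ∈ L^1_loc, ‖[b,T]‖_{L^p(μ)→L^q(λ)} ≤ (‖T‖_{L^p(μ)→L^p(μ)} + ‖T‖_{L^q(λ)→L^q(λ)}) · inf_c ‖f ↦ (b−c)f‖_{L^p(μ)→L^q(λ)}. (ii) For every pair 1<q<p<∞ there exist μ ∈ A_p, λ ∈ A_q and b ∈ L^1_loc such that inf_c ‖f ↦ (b−c)f‖_{L^p(μ)→L^q(λ)} = ∞ while ‖[b,T]‖_{L^p(μ)→L^q(λ)} < ∞; in particular the multiplier condition is not necessary for the boundedness of the commutator. -/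
open MeasureTheory ENNReal Set Filter

noncomputable section

/-- `ℝ^d` with the Euclidean structure. -/
abbrev Rd (d : ℕ) := EuclideanSpace ℝ (Fin d)

variable {d : ℕ}

/-- An axis-parallel cube in `ℝ^d`, given by a corner and a (positive) side length. -/
structure Cube (d : ℕ) where
  corner : Fin d → ℝ
  side : ℝ
  side_pos : 0 < side

namespace Cube

/-- The set of points of the cube. -/
def carrier (Q : Cube d) : Set (Rd d) :=
  {x | ∀ i, Q.corner i ≤ x i ∧ x i < Q.corner i + Q.side}

/-- The volume `|Q| = ℓ(Q)^d` of the cube. -/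
def vol (Q : Cube d) : ℝ := Q.side ^ d

/-- The concentric cube with twice the side length. -/
def double (Q : Cube d) : Cube d :=
  ⟨fun i => Q.corner i - Q.side / 2, 2 * Q.side, by have := Q.side_pos; linarith⟩

end Cube

/-- `∫_Q f`. -/
def intC (Q : Cube d) (f : Rd d → ℝ) : ℝ := ∫ x in Q.carrier, f x

/-- `w(Q) = ∫_Q w`. -/
def wInt (Q : Cube d) (w : Rd d → ℝ) : ℝ := intC Q w

/-- The average `⟨f⟩_Q = |Q|⁻¹ ∫_Q f`. -/
def avg (Q : Cube d) (f : Rd d → ℝ) : ℝ := Q.vol⁻¹ * intC Q f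

/-- The mean oscillation `∫_Q |f - ⟨f⟩_Q|`. -/
def osc (Q : Cube d) (b : Rd d → ℝ) : ℝ := ∫ x in Q.carrier, |b x - avg Q b|

/-- The conjugate (dual) exponent `p' = p/(p-1)`. -/
def conj (p : ℝ) : ℝ := p / (p - 1)

/-- The weighted Lebesgue norm `‖f‖_{L^p(w)} = (∫ |f|^p w dx)^{1/p}`. -/
def wnorm (p : ℝ) (w : Rd d → ℝ) (f : Rd d → ℝ) : ℝ≥0∞ :=
  (∫⁻ x, ENNReal.ofReal (|f x| ^ p * w x)) ^ (1 / p)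

/-- The weighted Lebesgue norm of an `ℝ≥0∞`-valued function. -/
def wnormE (p : ℝ) (w : Rd d → ℝ) (f : Rd d → ℝ≥0∞) : ℝ≥0∞ :=
  (∫⁻ x, f x ^ p * ENNReal.ofReal (w x)) ^ (1 / p)

/-- A weight: a positive, measurable, locally integrable function. -/
def IsWeight (w : Rd d → ℝ) : Prop :=
  (∀ x, 0 < w x) ∧ Measurable w ∧ LocallyIntegrable w volume

/-- `b ∈ L¹_loc`. -/
def L1loc (b : Rd d → ℝ) : Prop := Measurable b ∧ LocallyIntegrable b volume

/-- Bounded measurable functions with compact support (the class `L^∞_c`). -/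
def BddCompactSupp (f : Rd d → ℝ) : Prop :=
  Measurable f ∧ HasCompactSupport f ∧ ∃ M : ℝ, ∀ x, |f x| ≤ M

/-- `‖U‖_{L^p(μ) → L^q(λ)} ≤ N`, tested on all measurable functions. -/
def OpBound (p q : ℝ) (μ lam : Rd d → ℝ) (U : (Rd d → ℝ) → Rd d → ℝ) (N : ℝ) : Prop :=
  ∀ f : Rd d → ℝ, Measurable f → wnorm q lam (U f) ≤ ENNReal.ofReal N * wnorm p μ f

/-- `‖U‖_{L^p(μ) → L^q(λ)} ≤ N`, tested on the dense class `L^∞_c`. -/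
def OpBoundCS (p q : ℝ) (μ lam : Rd d → ℝ) (U : (Rd d → ℝ) → Rd d → ℝ) (N : ℝ) : Prop :=
  ∀ f : Rd d → ℝ, BddCompactSupp f → wnorm q lam (U f) ≤ ENNReal.ofReal N * wnorm p μ f

/-- The weighted sharp maximal function, with cubes restricted to the family `𝒟`. -/
def sharpMaxOn (𝒟 : Set (Cube d)) (ν b : Rd d → ℝ) (x : Rd d) : ℝ≥0∞ :=
  ⨆ (Q : Cube d) (_ : Q ∈ 𝒟) (_ : x ∈ Q.carrier), ENNReal.ofReal (osc Q b / wInt Q ν)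

/-- `‖M^♯_ν b‖_{L^r(ν)}`. -/
def sharpNormOn (𝒟 : Set (Cube d)) (r : ℝ) (ν b : Rd d → ℝ) : ℝ≥0∞ :=
  wnormE r ν (sharpMaxOn 𝒟 ν b)

/-- `‖b‖_{BMO_ν^α} = sup_Q ν(Q)^{-e} ∫_Q |b - ⟨b⟩_Q|` with `e = 1 + α/d`. -/
def bmoNormOn (𝒟 : Set (Cube d)) (e : ℝ) (ν b : Rd d → ℝ) : ℝ≥0∞ :=
  ⨆ (Q : Cube d) (_ : Q ∈ 𝒟), ENNReal.ofReal (osc Q b / wInt Q ν ^ e)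

/-- The Muckenhoupt `A_p` characteristic over the family `𝒟`. -/
def ApCharOn (𝒟 : Set (Cube d)) (p : ℝ) (w : Rd d → ℝ) : ℝ≥0∞ :=
  ⨆ (Q : Cube d) (_ : Q ∈ 𝒟),
    ENNReal.ofReal (avg Q w * avg Q (fun x => w x ^ (-(conj p / p))) ^ (p / conj p))

/-- `w ∈ A_p` (over the family `𝒟`). -/
def IsApOn (𝒟 : Set (Cube d)) (p : ℝ) (w : Rd d → ℝ) : Prop :=
  IsWeight w ∧ LocallyIntegrable (fun x => w x ^ (-(conj p / p))) volume ∧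
    ApCharOn 𝒟 p w < ⊤

/-- The Fujii–Wilson `A_∞` characteristic over the family `𝒟`. -/
def AinfCharOn (𝒟 : Set (Cube d)) (w : Rd d → ℝ) : ℝ≥0∞ :=
  ⨆ (Q : Cube d) (_ : Q ∈ 𝒟),
    (∫⁻ x in Q.carrier,
        ⨆ (R : Cube d) (_ : R ∈ 𝒟) (_ : x ∈ R.carrier),
          ENNReal.ofReal ((∫ y in Q.carrier ∩ R.carrier, w y) / R.vol)) /
      ENNReal.ofReal (wInt Q w)

/-- The relative Fujii–Wilson characteristic `[w]_{A_∞(ν)}` over the family `𝒟`. -/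
def relAinfOn (𝒟 : Set (Cube d)) (w ν : Rd d → ℝ) : ℝ≥0∞ :=
  ⨆ (Q : Cube d) (_ : Q ∈ 𝒟),
    (∫⁻ x in Q.carrier,
        (⨆ (R : Cube d) (_ : R ∈ 𝒟) (_ : R.carrier ⊆ Q.carrier) (_ : x ∈ R.carrier),
          ENNReal.ofReal (wInt R w / wInt R ν)) * ENNReal.ofReal (ν x)) /
      ENNReal.ofReal (wInt Q w)

/-- The joint Bloom–Muckenhoupt characteristic `[μ',λ,ν]_{B_{p',q}}` (for upper bounds). -/
def BupperOn (𝒟 : Set (Cube d)) (p q : ℝ) (μ' lam ν : Rd d → ℝ) : ℝ≥0∞ :=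
  ⨆ (Q : Cube d) (_ : Q ∈ 𝒟),
    ENNReal.ofReal (avg Q μ' ^ (1 / conj p) * avg Q lam ^ (1 / q) *
      avg Q ν ^ (1 / p + 1 / conj q))

/-- The joint Bloom–Muckenhoupt characteristic `[μ,λ']_{B_{p,q'}(ν)}` (for lower bounds). -/
def BlowerOn (𝒟 : Set (Cube d)) (p q : ℝ) (μ lam' ν : Rd d → ℝ) : ℝ≥0∞ :=
  ⨆ (Q : Cube d) (_ : Q ∈ 𝒟),
    ENNReal.ofReal ((wInt Q μ / wInt Q ν) ^ (1 / p) * (wInt Q lam' / wInt Q ν) ^ (1 / conj q))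

/-- A doubling weight. -/
def DoublingWeight (w : Rd d → ℝ) : Prop :=
  ∃ C : ℝ, 0 < C ∧ ∀ Q : Cube d, wInt Q.double w ≤ C * wInt Q w

/-- A `(γ, ν)`-sparse collection of cubes (with respect to a weight `ν`). -/
def SparseFamily (γ : ℝ) (ν : Rd d → ℝ) (S : Set (Cube d)) : Prop :=
  ∃ E : Cube d → Set (Rd d),
    (∀ Q ∈ S, E Q ⊆ Q.carrier ∧ MeasurableSet (E Q) ∧ γ * wInt Q ν ≤ ∫ x in E Q, ν x) ∧
    S.Pairwise fun Q R => Disjoint (E Q) (E R)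

/-- A `(γ, ν)`-sparse collection of cubes (with respect to a measure `ν`). -/
def MSparseFamily (γ : ℝ) (ν : Measure (Rd d)) (S : Set (Cube d)) : Prop :=
  ∃ E : Cube d → Set (Rd d),
    (∀ Q ∈ S, E Q ⊆ Q.carrier ∧ ENNReal.ofReal γ * ν Q.carrier ≤ ν (E Q)) ∧
    S.Pairwise fun Q R => Disjoint (E Q) (E R)

/-- The weighted sharp maximal function with respect to a measure `ν`. -/
def mSharpMaxOn (𝒟 : Set (Cube d)) (ν : Measure (Rd d)) (b : Rd d → ℝ) (x : Rd d) : ℝ≥0∞ :=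
  ⨆ (Q : Cube d) (_ : Q ∈ 𝒟) (_ : x ∈ Q.carrier), ENNReal.ofReal (osc Q b) / ν Q.carrier

/-- The distance between two sets in `ℝ^d`. -/
def setDist (s t : Set (Rd d)) : ℝ := sInf {r | ∃ x ∈ s, ∃ y ∈ t, r = dist x y}

/-- Supports separated by a positive distance. -/
def SeparatedSupports (f g : Rd d → ℝ) : Prop :=
  ∃ ε : ℝ, 0 < ε ∧ ∀ x ∈ tsupport f, ∀ y ∈ tsupport g, ε ≤ dist x y

/-- A dyadic lattice on `ℝ^d`: for every `k ∈ ℤ` a partition of `ℝ^d` into cubes of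
side length `2^{-k}`, each refining the previous one. -/
structure DyadicLattice (d : ℕ) where
  layer : ℤ → Set (Cube d)
  side_eq : ∀ k : ℤ, ∀ Q ∈ layer k, Q.side = (2 : ℝ) ^ (-k)
  covers : ∀ k : ℤ, ∀ x : Rd d, ∃ Q ∈ layer k, x ∈ Q.carrier
  pairwiseDisjoint : ∀ k : ℤ, ∀ Q ∈ layer k, ∀ R ∈ layer k,
    Q ≠ R → Q.carrier ∩ R.carrier = ∅
  refines : ∀ k : ℤ, ∀ Q ∈ layer (k + 1), ∃ R ∈ layer k, Q.carrier ⊆ R.carrier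

/-- The cubes of a dyadic lattice. -/
def DyadicLattice.cubes (D : DyadicLattice d) : Set (Cube d) := {Q | ∃ k, Q ∈ D.layer k}

/-- `𝒟(Q₀)`: the dyadic cubes contained in `Q₀`. -/
def DyadicLattice.below (D : DyadicLattice d) (Q₀ : Cube d) : Set (Cube d) :=
  {Q ∈ D.cubes | Q.carrier ⊆ Q₀.carrier}

open Classical in
/-- The martingale difference `D_Q b = Σ_{R : R̂ = Q} ⟨b⟩_R 1_R − ⟨b⟩_Q 1_Q`. -/
def DyadicLattice.DQ (D : DyadicLattice d) (Q : Cube d) (b : Rd d → ℝ) (x : Rd d) : ℝ :=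
  if h : x ∈ Q.carrier ∧
      ∃ R, R ∈ D.cubes ∧ R.side = Q.side / 2 ∧ x ∈ R.carrier ∧ R.carrier ⊆ Q.carrier
  then avg h.2.choose b - avg Q b
  else 0

/-- Finite partial sums `Σ_{Q ∈ F} D_Q b ⟨f⟩_Q` of the paraproduct. -/
def parasum (D : DyadicLattice d) (b f : Rd d → ℝ) (F : Finset (Cube d)) (x : Rd d) : ℝ :=
  ∑ Q ∈ F, D.DQ Q b x * avg Q f

/-- Unconditional convergence of the paraproduct sum in `L¹_loc` to the function `S`. -/
def UncondConvL1loc (D : DyadicLattice d) (b f S : Rd d → ℝ) : Prop :=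
  ∀ K : Set (Rd d), IsCompact K → ∀ ε : ℝ, 0 < ε →
    ∃ F₀ : Finset (Cube d), ↑F₀ ⊆ D.cubes ∧
      ∀ F : Finset (Cube d), ↑F ⊆ D.cubes → F₀ ⊆ F →
        ∫ x in K, |parasum D b f F x - S x| < ε

/-- `P` is the dyadic paraproduct `Π_b` associated to `b` and the lattice `D`. -/
def IsParaproduct (D : DyadicLattice d) (b : Rd d → ℝ) (P : (Rd d → ℝ) → Rd d → ℝ) : Prop :=
  ∀ f : Rd d → ℝ, BddCompactSupp f → UncondConvL1loc D b f (P f)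

/-- Unconditional convergence of the paraproduct sum in `L^q(λ)` to the function `S`. -/
def UncondConvLq (D : DyadicLattice d) (q : ℝ) (lam : Rd d → ℝ) (b f S : Rd d → ℝ) : Prop :=
  ∀ ε : ℝ, 0 < ε →
    ∃ F₀ : Finset (Cube d), ↑F₀ ⊆ D.cubes ∧
      ∀ F : Finset (Cube d), ↑F ⊆ D.cubes → F₀ ⊆ F →
        wnorm q lam (fun x => parasum D b f F x - S x) < ENNReal.ofReal ε

/-- A modulus of continuity: increasing with `ω(t) → 0` as `t → 0`. -/
def ModulusOfContinuity (ω : ℝ → ℝ) : Prop :=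
  Monotone ω ∧ (∀ t, 0 ≤ ω t) ∧ Tendsto ω (nhdsWithin 0 (Ioi 0)) (nhds 0)

/-- The Dini condition `∫₀¹ ω(t)/t dt < ∞`. -/
def DiniCondition (ω : ℝ → ℝ) : Prop :=
  IntegrableOn (fun t => ω t / t) (Ioc (0 : ℝ) 1) volume

/-- An `ω`-Calderón–Zygmund kernel. -/
structure CZKernel (d : ℕ) (ω : ℝ → ℝ) where
  kernel : Rd d → Rd d → ℝ
  CK : ℝ
  CK_pos : 0 < CK
  size : ∀ x y : Rd d, x ≠ y → |kernel x y| ≤ CK / dist x y ^ d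
  smooth : ∀ x x' y : Rd d, x ≠ y → dist x x' ≤ dist x y / 2 →
    |kernel x y - kernel x' y| + |kernel y x - kernel y x'| ≤
      1 / dist x y ^ d * ω (dist x x' / dist x y)

/-- Non-degeneracy of a Calderón–Zygmund kernel. -/
def CZKernel.NonDegenerate {d : ℕ} {ω : ℝ → ℝ} (K : CZKernel d ω) : Prop :=
  ∃ c : ℝ, 0 < c ∧ ∀ (x : Rd d) (r : ℝ), 0 < r →
    ∃ y : Rd d, c * r ≤ dist x y ∧ c / r ^ d ≤ |K.kernel y x|

/-- An `ω`-Calderón–Zygmund operator: a linear operator, bounded on some `L^{p₀}`, with an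
`ω`-Calderón–Zygmund kernel representation off the support. -/
structure CZOperator (d : ℕ) (ω : ℝ → ℝ) extends CZKernel d ω where
  T : (Rd d → ℝ) → Rd d → ℝ
  map_add : ∀ f g : Rd d → ℝ, T (f + g) = T f + T g
  map_smul : ∀ (c : ℝ) (f : Rd d → ℝ), T (c • f) = c • T f
  measurable_map : ∀ f : Rd d → ℝ, Measurable f → Measurable (T f)
  p₀ : ℝ
  one_lt_p₀ : 1 < p₀
  N₀ : ℝ
  bounded : ∀ f : Rd d → ℝ, Measurable f →
    wnorm p₀ (fun _ => 1) (T f) ≤ ENNReal.ofReal N₀ * wnorm p₀ (fun _ => 1) f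
  kernel_repr : ∀ f : Rd d → ℝ, BddCompactSupp f → ∀ x ∉ tsupport f,
    T f x = ∫ y, kernel x y * f y

/-- The commutator `[b, T] f = b · Tf − T(b f)`. -/
def commutatorOp (b : Rd d → ℝ) (T : (Rd d → ℝ) → Rd d → ℝ) : (Rd d → ℝ) → Rd d → ℝ :=
  fun f x => b x * T f x - T (fun y => b y * f y) x

/-- The sparse operator `𝒜^⋆_{S,b} f = Σ_{Q∈S} ⟨|b − ⟨b⟩_Q| |f|⟩_Q 1_Q`. -/
def sparseOpStar (S : Set (Cube d)) (b f : Rd d → ℝ) (x : Rd d) : ℝ≥0∞ :=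
  ∑' Q : S, (Q : Cube d).carrier.indicator
      (fun _ => ENNReal.ofReal (avg (Q : Cube d) fun y => |b y - avg (Q : Cube d) b| * |f y|)) x

/-- The sparse operator `f ↦ Σ_{Q∈S} ⟨|b − ⟨b⟩_Q|⟩_Q ⟨|f|⟩_Q 1_Q`. -/
def sparseOp2 (S : Set (Cube d)) (b f : Rd d → ℝ) (x : Rd d) : ℝ≥0∞ :=
  ∑' Q : S, (Q : Cube d).carrier.indicator
      (fun _ => ENNReal.ofReal ((avg (Q : Cube d) fun y => |b y - avg (Q : Cube d) b|) *
        avg (Q : Cube d) fun y => |f y|)) x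

/-- The sparse operator `f ↦ Σ_{Q∈S} (|Q|^{-s} ∫_Q |f|^s)^{1/s} 1_Q`. -/
def sparseOpPow (S : Set (Cube d)) (s : ℝ) (f : Rd d → ℝ) (x : Rd d) : ℝ≥0∞ :=
  ∑' Q : S, (Q : Cube d).carrier.indicator
      (fun _ => ENNReal.ofReal (((Q : Cube d).vol ^ (-s) *
        intC (Q : Cube d) fun y => |f y| ^ s) ^ (1 / s))) x

lemma wnorm_eq {p : ℝ} (hp : 0 < p) (w f : Rd d → ℝ) :
    wnorm p w f =
      (∫⁻ x, (‖f x‖ₑ * ENNReal.ofReal (w x) ^ (1 / p)) ^ p) ^ (1 / p) := by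
  unfold wnorm
  congr 2
  ext x
  rw [ENNReal.mul_rpow_of_nonneg _ _ hp.le, ← ENNReal.rpow_mul, one_div_mul_cancel hp.ne',
    ENNReal.rpow_one, Real.enorm_eq_ofReal_abs, ENNReal.ofReal_mul (by positivity),
    ENNReal.ofReal_rpow_of_nonneg (abs_nonneg _) hp.le]

lemma wnorm_sub_le {p : ℝ} (hp : 1 ≤ p) {w : Rd d → ℝ} (hwm : Measurable w)
    {f g : Rd d → ℝ} (hf : Measurable f) (hg : Measurable g) :
    wnorm p w (fun x => f x - g x) ≤ wnorm p w f + wnorm p w g := by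
  have hp0 : 0 < p := by linarith
  rw [wnorm_eq hp0, wnorm_eq hp0, wnorm_eq hp0]
  refine le_trans ?_ (ENNReal.lintegral_Lp_add_le (by fun_prop) (by fun_prop) hp)
  gcongr with x
  rw [Pi.add_apply, ← add_mul]
  gcongr
  exact enorm_sub_le

/-- A commutator with `b` is unchanged when a constant is subtracted from `b`. -/
lemma commutatorOp_eq_sub_const {ω : ℝ → ℝ} (T : CZOperator d ω) (b : Rd d → ℝ) (c : ℝ)
    (f : Rd d → ℝ) : commutatorOp b T.T f =
      fun x => (b x - c) * T.T f x - T.T (fun y => (b y - c) * f y) x := by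
  have h : (fun y => (b y - c) * f y) = (fun y => b y * f y) + (-c) • f := by
    ext y
    simp only [Pi.add_apply, Pi.smul_apply, smul_eq_mul]
    ring
  ext x
  rw [h, T.map_add, T.map_smul]
  simp only [commutatorOp, Pi.add_apply, Pi.smul_apply, smul_eq_mul]
  ring

lemma opBound_commutatorOp {ω : ℝ → ℝ} (T : CZOperator d ω) {p q : ℝ} (hq : 1 < q)
    {μ lam : Rd d → ℝ} (hlam : IsWeight lam) {b : Rd d → ℝ} (hb : Measurable b) {Np Nq : ℝ}
    (hNp : 0 ≤ Np) (hNq : 0 ≤ Nq) (hTp : OpBound p p μ μ T.T Np) (hTq : OpBound q q lam lam T.T Nq)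
    {c Nc : ℝ} (hbc : OpBound p q μ lam (fun f x => (b x - c) * f x) Nc) :
    OpBound p q μ lam (commutatorOp b T.T) ((Np + Nq) * Nc) := by
  intro f hf
  have hTf := T.measurable_map f hf
  have hbf : Measurable fun y => (b y - c) * f y := by fun_prop
  have hTbf := T.measurable_map _ hbf
  rw [commutatorOp_eq_sub_const T b c]
  calc _ ≤ wnorm q lam (fun x => (b x - c) * T.T f x)
        + wnorm q lam (T.T fun y => (b y - c) * f y) :=
        wnorm_sub_le hq.le hlam.2.1 (by fun_prop) hTbf
    _ ≤ ENNReal.ofReal Nc * (ENNReal.ofReal Np * wnorm p μ f)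
        + ENNReal.ofReal Nq * (ENNReal.ofReal Nc * wnorm p μ f) := by
        gcongr
        · exact (hbc _ hTf).trans (by gcongr; exact hTp f hf)
        · exact (hTq _ hbf).trans (by gcongr; exact hbc f hf)
    _ = _ := by
        rw [ENNReal.ofReal_mul (by positivity), ENNReal.ofReal_add hNp hNq]
        ring

lemma Cube.measurableSet_carrier (Q : Cube d) : MeasurableSet Q.carrier := by
  have : Q.carrier = ⋂ i, {x : Rd d | Q.corner i ≤ x i ∧ x i < Q.corner i + Q.side} := by
    ext x
    simp [Cube.carrier]
  rw [this]
  exact MeasurableSet.iInter fun i =>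
    measurableSet_Ico.preimage (f := fun x : Rd d => x i) (by fun_prop)

lemma Cube.vol_pos (Q : Cube d) : 0 < Q.vol := pow_pos Q.side_pos d

lemma Cube.volume_carrier (Q : Cube d) : volume Q.carrier = ENNReal.ofReal Q.vol := by
  have h : Q.carrier = (WithLp.ofLp : Rd d → Fin d → ℝ) ⁻¹'
      (Set.univ.pi fun i => Ico (Q.corner i) (Q.corner i + Q.side)) := by
    ext x
    simp [Cube.carrier]
  rw [h, (PiLp.volume_preserving_ofLp (Fin d)).measure_preimage
    (MeasurableSet.univ_pi fun _ => measurableSet_Ico).nullMeasurableSet, Real.volume_pi_Ico]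
  simp [Cube.vol, ENNReal.ofReal_pow Q.side_pos.le]

lemma Cube.volume_real_carrier (Q : Cube d) : volume.real Q.carrier = Q.vol := by
  rw [Measure.real, Q.volume_carrier, ENNReal.toReal_ofReal Q.vol_pos.le]

lemma Cube.carrier_subset_closedBall (Q : Cube d) :
    Q.carrier ⊆ Metric.closedBall (WithLp.toLp 2 Q.corner) (Real.sqrt d * Q.side) := by
  intro x hx
  rw [Metric.mem_closedBall, EuclideanSpace.dist_eq]
  calc _ ≤ Real.sqrt (∑ _i : Fin d, Q.side ^ 2) := by
        gcongr with i
        rw [Real.dist_eq, abs_le]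
        have := hx i
        have := Q.side_pos
        constructor <;> simp only <;> linarith
    _ = _ := by
        simp only [Finset.sum_const, Finset.card_univ, Fintype.card_fin, nsmul_eq_mul]
        rw [Real.sqrt_mul (by positivity), Real.sqrt_sq Q.side_pos.le]

lemma integrableOn_cube (Q : Cube d) {f : Rd d → ℝ} (hf : LocallyIntegrable f volume) :
    IntegrableOn f Q.carrier volume :=
  (hf.integrableOn_isCompact (isCompact_closedBall _ _)).mono_set Q.carrier_subset_closedBall

/-- If `f ≤ c` almost everywhere on a cube, then its average is at most `c`. -/
lemma avg_le_of_ae_le (Q : Cube d) {f : Rd d → ℝ} (hf : IntegrableOn f Q.carrier volume) {c : ℝ}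
    (h : ∀ᵐ x, x ∈ Q.carrier → f x ≤ c) : avg Q f ≤ c := by
  have h1 : intC Q f ≤ c * Q.vol := by
    have := setIntegral_mono_on_ae hf (integrableOn_const (C := c) (by simp [Q.volume_carrier]))
      Q.measurableSet_carrier h
    simpa [intC, Q.volume_real_carrier, mul_comm] using this
  rw [avg, inv_mul_le_iff₀ Q.vol_pos]
  linarith

lemma avg_nonneg (Q : Cube d) {f : Rd d → ℝ} (hf : ∀ x, 0 ≤ f x) : 0 ≤ avg Q f :=
  mul_nonneg (inv_nonneg.2 Q.vol_pos.le) (integral_nonneg hf)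

/-- A weight bounded below by one that satisfies an `A_1`-type estimate is an `A_q` weight. -/
lemma isApOn_of_avg_le {q : ℝ} (hq : 1 < q) {w : Rd d → ℝ} (hw : IsWeight w)
    (hw1 : ∀ x, 1 ≤ w x) {C : ℝ}
    (h : ∀ Q : Cube d, ∃ t : ℝ, 0 < t ∧ avg Q w ≤ C * t ∧ ∀ᵐ x, x ∈ Q.carrier → t ≤ w x) :
    IsApOn Set.univ q w := by
  have hq1 : 0 < q - 1 := by linarith
  have he : conj q / q = 1 / (q - 1) := by
    rw [conj]
    field_simp
  have he' : q / conj q = q - 1 := by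
    rw [conj]
    field_simp
  have hs : 0 ≤ conj q / q := by rw [he]; positivity
  have hmeas : Measurable fun x => w x ^ (-(conj q / q)) := hw.2.1.pow_const _
  have hloc : LocallyIntegrable (fun x => w x ^ (-(conj q / q))) volume := by
    refine (locallyIntegrable_const (1 : ℝ)).mono hmeas.aestronglyMeasurable (.of_forall fun x => ?_)
    rw [Real.norm_of_nonneg (Real.rpow_nonneg (hw.1 x).le _), norm_one]
    exact Real.rpow_le_one_of_one_le_of_nonpos (hw1 x) (by linarith)
  refine ⟨hw, hloc, lt_of_le_of_lt (iSup₂_le fun Q _ => ?_) (ENNReal.ofReal_lt_top (r := C))⟩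
  obtain ⟨t, ht, hQt, htw⟩ := h Q
  gcongr
  have hdual : avg Q (fun x => w x ^ (-(conj q / q))) ≤ t ^ (-(conj q / q)) := by
    refine avg_le_of_ae_le Q (integrableOn_cube Q hloc) ?_
    filter_upwards [htw] with x hx hxQ
    exact Real.rpow_le_rpow_of_nonpos ht (hx hxQ) (by linarith)
  calc _ ≤ (C * t) * (t ^ (-(conj q / q))) ^ (q / conj q) := by
        have := avg_nonneg Q (f := fun x => w x ^ (-(conj q / q)))
          fun x => Real.rpow_nonneg (hw.1 x).le _
        have := avg_nonneg Q (f := w) fun x => (hw.1 x).le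
        have : 0 ≤ q / conj q := by rw [he']; linarith
        gcongr
        linarith
    _ = C := by
        rw [← Real.rpow_mul ht.le, he, he',
          show -(1 / (q - 1)) * (q - 1) = -1 by field_simp, Real.rpow_neg_one]
        field_simp

/-- The weight `1 + ‖x‖ ^ (-α)`. -/
def singWeight (α : ℝ) (x : Rd d) : ℝ := 1 + ‖x‖ ^ (-α)

lemma one_le_singWeight (α : ℝ) (x : Rd d) : 1 ≤ singWeight α x := by
  have : 0 ≤ ‖x‖ ^ (-α) := by positivity
  rw [singWeight]
  linarith

lemma measurable_singWeight (α : ℝ) : Measurable (singWeight α : Rd d → ℝ) := by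
  unfold singWeight
  fun_prop

lemma locallyIntegrable_norm_rpow (hd : 0 < d) {α : ℝ} (hα : α < d) :
    LocallyIntegrable (fun x : Rd d => ‖x‖ ^ (-α)) volume := by
  refine locallyIntegrable_of_norm_le_rpow (C := 1) (α := α) (by simpa using Nat.succ_le_of_lt hd)
    (by simpa using hα) (.of_forall fun x => ?_) ?_
  · rw [one_mul, Real.norm_of_nonneg (by positivity)]
  · exact Measurable.aestronglyMeasurable (by fun_prop)

lemma isWeight_singWeight (hd : 0 < d) {α : ℝ} (hα : α < d) :
    IsWeight (singWeight α : Rd d → ℝ) :=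
  ⟨fun x => one_pos.trans_le (one_le_singWeight α x), measurable_singWeight α,
    (locallyIntegrable_const 1).add (locallyIntegrable_norm_rpow hd hα)⟩

open scoped Pointwise in
lemma setIntegral_ball_norm_rpow (α : ℝ) {R : ℝ} (hR : 0 < R) :
    ∫ x in Metric.ball (0 : Rd d) R, ‖x‖ ^ (-α) =
      R ^ d * R ^ (-α) * ∫ x in Metric.ball (0 : Rd d) 1, ‖x‖ ^ (-α) := by
  have h := Measure.setIntegral_comp_smul_of_pos volume (fun x : Rd d => ‖x‖ ^ (-α))
    (Metric.ball 0 1) hR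
  have hball : R • Metric.ball (0 : Rd d) 1 = Metric.ball 0 R := by
    rw [smul_unitBall_of_pos hR]
  simp only [norm_smul, Real.norm_of_nonneg hR.le, Real.mul_rpow hR.le (norm_nonneg _),
    integral_const_mul, hball, finrank_euclideanSpace, Fintype.card_fin, smul_eq_mul] at h
  rw [mul_assoc, h]
  field_simp

lemma isApOn_singWeight (hd : 0 < d) {α : ℝ} (hα0 : 0 ≤ α) (hα : α < d) {q : ℝ} (hq : 1 < q) :
    IsApOn Set.univ q (singWeight α : Rd d → ℝ) := by
  have hw := isWeight_singWeight hd hα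
  have : Nonempty (Fin d) := ⟨⟨0, hd⟩⟩
  have hnorm : LocallyIntegrable (fun x : Rd d => ‖x‖ ^ (-α)) volume :=
    locallyIntegrable_norm_rpow hd hα
  have hne : ∀ᵐ x : Rd d, 0 < ‖x‖ := by
    filter_upwards [Measure.ae_ne volume (0 : Rd d)] with x hx using norm_pos_iff.2 hx
  set I := ∫ x in Metric.ball (0 : Rd d) 1, ‖x‖ ^ (-α) with hI
  have hI0 : 0 ≤ I := integral_nonneg fun x => by positivity
  have hd' : (0 : ℝ) < d := by exact_mod_cast hd
  refine isApOn_of_avg_le hq hw (one_le_singWeight α)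
    (C := 3 ^ α + 1 + (4 * Real.sqrt d) ^ d * I) fun Q => ?_
  set D := Real.sqrt d * Q.side with hD
  have hD0 : 0 < D := mul_pos (Real.sqrt_pos.2 hd') Q.side_pos
  set z : Rd d := WithLp.toLp 2 Q.corner
  have hQ : ∀ x ∈ Q.carrier, ‖x - z‖ ≤ D := fun x hx => by
    simpa [dist_eq_norm] using Q.carrier_subset_closedBall hx
  have h3 : (1 : ℝ) ≤ 3 ^ α := Real.one_le_rpow (by norm_num) hα0
  have hKI : 0 ≤ (4 * Real.sqrt d) ^ d * I := by positivity
  by_cases hz : 2 * D ≤ ‖z‖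
  · have hz0 : 0 < ‖z‖ := by linarith
    have ht : 0 < (3 * ‖z‖ / 2) ^ (-α) := by positivity
    refine ⟨1 + (3 * ‖z‖ / 2) ^ (-α), by positivity, ?_, ?_⟩
    · calc avg Q (singWeight α) ≤ 1 + (‖z‖ / 2) ^ (-α) := by
            refine avg_le_of_ae_le Q (integrableOn_cube Q hw.2.2) (.of_forall fun x hx => ?_)
            have h1 := hQ x hx
            have h2 := norm_sub_norm_le z x
            rw [norm_sub_rev] at h2
            exact add_le_add_right
              (Real.rpow_le_rpow_of_nonpos (by linarith) (by linarith) (by linarith)) _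
        _ = 1 + 3 ^ α * (3 * ‖z‖ / 2) ^ (-α) := by
            rw [mul_div_assoc, Real.mul_rpow (by norm_num) (by positivity), ← mul_assoc,
              ← Real.rpow_add (by norm_num)]
            simp
        _ ≤ _ := by nlinarith
    · filter_upwards [hne] with x hx0 hxQ
      have h1 := hQ x hxQ
      have h2 := norm_sub_norm_le x z
      exact add_le_add_right
        (Real.rpow_le_rpow_of_nonpos hx0 (by linarith) (by linarith)) _
  · have hsub : ∀ x ∈ Q.carrier, ‖x‖ < 4 * D := fun x hx => by
      have h1 := hQ x hx
      have h2 := norm_sub_norm_le x z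
      linarith
    have ht : 0 < (4 * D) ^ (-α) := by positivity
    refine ⟨1 + (4 * D) ^ (-α), by positivity, ?_, ?_⟩
    · have hint : intC Q (singWeight α) ≤ Q.vol + (4 * D) ^ d * (4 * D) ^ (-α) * I := by
        rw [intC]
        unfold singWeight
        rw [integral_add (integrableOn_cube Q (locallyIntegrable_const 1))
          (integrableOn_cube Q hnorm), hI, ← setIntegral_ball_norm_rpow α (by positivity)]
        refine add_le_add (by simp [Q.volume_real_carrier]) ?_
        refine setIntegral_mono_set ?_ (.of_forall fun x => by positivity)
          (.of_forall fun x hx => mem_ball_zero_iff.2 (hsub x hx))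
        exact (hnorm.integrableOn_isCompact (isCompact_closedBall _ _)).mono_set
          Metric.ball_subset_closedBall
      calc avg Q (singWeight α) ≤ Q.vol⁻¹ * (Q.vol + (4 * D) ^ d * (4 * D) ^ (-α) * I) := by
            have := Q.vol_pos
            rw [avg]
            gcongr
        _ = 1 + (4 * Real.sqrt d) ^ d * I * (4 * D) ^ (-α) := by
            have := Q.vol_pos
            have h4 : (4 * D) ^ d = (4 * Real.sqrt d) ^ d * Q.vol := by
              rw [hD, Cube.vol]
              ring
            rw [h4]
            field_simp
        _ ≤ _ := by nlinarith
    · filter_upwards [hne] with x hx0 hxQ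
      exact add_le_add_right
        (Real.rpow_le_rpow_of_nonpos hx0 (hsub x hxQ).le (by linarith)) _

lemma isApOn_one {p : ℝ} (hp : 1 < p) : IsApOn Set.univ p (fun _ : Rd d => (1 : ℝ)) := by
  refine isApOn_of_avg_le hp ⟨fun _ => one_pos, measurable_const, locallyIntegrable_const 1⟩
    (fun _ => le_rfl) (C := 1) fun Q => ⟨1, one_pos, ?_, .of_forall fun _ _ => le_rfl⟩
  rw [mul_one]
  exact avg_le_of_ae_le Q (integrableOn_cube Q (locallyIntegrable_const 1))
    (.of_forall fun _ _ => le_rfl)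

lemma wnorm_le_mul {p : ℝ} (hp : 0 < p) {w f g : Rd d → ℝ} {ε : ℝ}
    (h : ∀ x, |f x| ≤ ε * |g x|) : wnorm p w f ≤ ENNReal.ofReal ε * wnorm p w g := by
  rw [wnorm_eq hp, wnorm_eq hp]
  calc _ ≤ (∫⁻ x, ENNReal.ofReal ε ^ p *
        (‖g x‖ₑ * ENNReal.ofReal (w x) ^ (1 / p)) ^ p) ^ (1 / p) := by
        gcongr with x
        rw [← ENNReal.mul_rpow_of_nonneg _ _ hp.le, ← mul_assoc]
        gcongr
        rw [Real.enorm_eq_ofReal_abs, Real.enorm_eq_ofReal_abs,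
          ← ENNReal.ofReal_mul' (abs_nonneg _)]
        exact ENNReal.ofReal_le_ofReal (h x)
    _ = _ := by
        rw [lintegral_const_mul' _ _ (by simp [hp.le]),
          ENNReal.mul_rpow_of_nonneg _ _ (by positivity), ← ENNReal.rpow_mul,
          mul_one_div_cancel hp.ne', ENNReal.rpow_one]

lemma wnorm_one {p : ℝ} (hp : 0 < p) (f : Rd d → ℝ) :
    wnorm p (fun _ => 1) f = (∫⁻ x, ‖f x‖ₑ ^ p) ^ (1 / p) := by
  simp [wnorm_eq hp]

lemma BddCompactSupp.integrable {f : Rd d → ℝ} (hf : BddCompactSupp f) :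
    Integrable f volume := by
  obtain ⟨M, hM⟩ := hf.2.2
  refine (integrableOn_iff_integrable_of_support_subset (subset_tsupport f)).1 ?_
  exact Measure.integrableOn_of_bounded hf.2.1.isCompact.measure_lt_top.ne
    hf.1.aestronglyMeasurable (M := M) (.of_forall hM)

lemma BddCompactSupp.bdd_mul {b f : Rd d → ℝ} (hf : BddCompactSupp f) (hb : Measurable b)
    (hb1 : ∀ x, |b x| ≤ 1) : BddCompactSupp fun x => b x * f x := by
  obtain ⟨M, hM⟩ := hf.2.2
  refine ⟨hb.mul hf.1, hf.2.1.mul_left, M, fun x => ?_⟩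
  rw [abs_mul]
  exact (mul_le_of_le_one_left (abs_nonneg _) (hb1 x)).trans (hM x)

lemma BddCompactSupp.indicator {f : Rd d → ℝ} (hf : BddCompactSupp f) {s : Set (Rd d)}
    (hs : MeasurableSet s) : BddCompactSupp (s.indicator f) := by
  obtain ⟨M, hM⟩ := hf.2.2
  refine ⟨hf.1.indicator hs, hf.2.1.mono fun x hx => ?_, M, fun x => ?_⟩
  · exact fun h => hx (by simp [h])
  · exact (norm_indicator_le_norm_self f x).trans (hM x)

lemma CZKernel.measurable_kernel {ω : ℝ → ℝ} (hω : ModulusOfContinuity ω) (K : CZKernel d ω)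
    (x : Rd d) : Measurable (K.kernel x) := by
  refine measurable_of_continuousOn_compl_singleton x fun y hy => ContinuousAt.continuousWithinAt ?_
  have hyx : y ≠ x := hy
  have hpos : 0 < dist y x := dist_pos.2 hyx
  rw [continuousAt_iff_punctured_nhds, tendsto_iff_dist_tendsto_zero]
  have hdist : Tendsto (fun y' => dist y y') (nhdsWithin y {y}ᶜ) (nhds 0) := by
    have : ContinuousAt (fun y' => dist y y') y := by fun_prop
    simpa using this.tendsto.mono_left nhdsWithin_le_nhds
  have hquot : Tendsto (fun y' => dist y y' / dist y x) (nhdsWithin y {y}ᶜ)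
      (nhdsWithin 0 (Ioi 0)) := by
    refine tendsto_nhdsWithin_iff.2 ⟨by simpa using hdist.div_const (dist y x), ?_⟩
    filter_upwards [self_mem_nhdsWithin] with y' hy'
    exact div_pos (dist_pos.2 (Ne.symm hy')) hpos
  have hlim := (hω.2.2.comp hquot).const_mul (1 / dist y x ^ d)
  rw [mul_zero] at hlim
  refine squeeze_zero' (.of_forall fun _ => dist_nonneg) ?_ hlim
  filter_upwards [hdist.eventually (ge_mem_nhds (half_pos hpos))] with y' hy'
  have h := K.smooth y y' x hyx hy'
  rw [dist_comm, Real.dist_eq]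
  exact (le_add_of_nonneg_left (abs_nonneg _)).trans h

/-- The positive kernel `C |b(x) - b(y)| |x - y|⁻ᵈ` applied to `|f|`. -/
def commMajorant (C : ℝ) (b f : Rd d → ℝ) (x : Rd d) : ℝ≥0∞ :=
  ∫⁻ y, ENNReal.ofReal (C * (|b x - b y| / dist x y ^ d)) * ‖f y‖ₑ

lemma enorm_commutatorOp_le_of_notMem_tsupport {ω : ℝ → ℝ} (hω : ModulusOfContinuity ω)
    (T : CZOperator d ω) {b : Rd d → ℝ} (hb : Measurable b) (hb1 : ∀ x, |b x| ≤ 1)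
    {f : Rd d → ℝ} (hf : BddCompactSupp f) {x : Rd d} (hx : x ∉ tsupport f) :
    ‖commutatorOp b T.T f x‖ₑ ≤ commMajorant T.CK b f x := by
  have hbf := hf.bdd_mul hb hb1
  have hsub : tsupport (fun y => b y * f y) ⊆ tsupport f :=
    closure_mono fun y hy => right_ne_zero_of_mul hy
  obtain ⟨δ, hδ, hball⟩ := Metric.isOpen_iff.1 (isClosed_tsupport f).isOpen_compl x hx
  have hK := T.measurable_kernel hω x
  have hint : ∀ g : Rd d → ℝ, BddCompactSupp g → tsupport g ⊆ tsupport f →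
      Integrable (fun y => T.kernel x y * g y) volume := by
    intro g hg hgf
    refine (hg.integrable.norm.const_mul (T.CK / δ ^ d)).mono'
      (hK.mul hg.1).aestronglyMeasurable (.of_forall fun y => ?_)
    rw [norm_mul]
    by_cases hy : g y = 0
    · simp [hy]
    have hy' : y ∉ Metric.ball x δ := fun h => hball h (hgf (subset_tsupport g hy))
    rw [Metric.mem_ball, not_lt, dist_comm] at hy'
    have hxy : x ≠ y := dist_pos.1 (hδ.trans_le hy')
    gcongr
    exact (T.size x y hxy).trans
      (div_le_div_of_nonneg_left T.CK_pos.le (by positivity) (by gcongr))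
  have hrep : commutatorOp b T.T f x = ∫ y, (b x - b y) * T.kernel x y * f y := by
    rw [commutatorOp, T.kernel_repr f hf x hx, T.kernel_repr _ hbf x fun h => hx (hsub h),
      ← integral_const_mul, ← integral_sub ((hint f hf le_rfl).const_mul _) (hint _ hbf hsub)]
    congr 1
    ext y
    ring
  rw [hrep]
  refine (enorm_integral_le_lintegral_enorm _).trans (lintegral_mono fun y => ?_)
  rw [enorm_mul]
  gcongr
  rw [Real.enorm_eq_ofReal_abs, abs_mul]
  apply ENNReal.ofReal_le_ofReal
  by_cases hxy : x = y
  · simp [hxy]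
  calc |b x - b y| * |T.kernel x y| ≤ |b x - b y| * (T.CK / dist x y ^ d) := by
        gcongr
        exact T.size x y hxy
    _ = _ := by ring

lemma CZOperator.commutatorOp_sum {ω : ℝ → ℝ} (T : CZOperator d ω) (b : Rd d → ℝ) {ι : Type*}
    (s : Finset ι) (f : ι → Rd d → ℝ) (x : Rd d) :
    commutatorOp b T.T (∑ i ∈ s, f i) x = ∑ i ∈ s, commutatorOp b T.T (f i) x := by
  let L : (Rd d → ℝ) →ₗ[ℝ] Rd d → ℝ := ⟨⟨T.T, T.map_add⟩, T.map_smul⟩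
  have h : (fun y => b y * (∑ i ∈ s, f i) y) = ∑ i ∈ s, fun y => b y * f i y := by
    ext y
    simp [Finset.mul_sum]
  have hL : ∀ g : ι → Rd d → ℝ, T.T (∑ i ∈ s, g i) = ∑ i ∈ s, T.T (g i) := fun g => map_sum L g s
  simp only [commutatorOp]
  rw [h, hL, hL]
  simp [Finset.mul_sum]

/-- On a set where `b` oscillates little, the localized commutator is small. -/
lemma lintegral_commutatorOp_indicator_le {ω : ℝ → ℝ} (T : CZOperator d ω) {b : Rd d → ℝ}
    (hb : Measurable b) {f : Rd d → ℝ} (hf : Measurable f) {s : Set (Rd d)}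
    (hs : MeasurableSet s) {c ε : ℝ} (hε : 0 ≤ ε) (hbs : ∀ x ∈ s, |b x - c| ≤ ε) :
    ∫⁻ x in s, ‖commutatorOp b T.T (s.indicator f) x‖ₑ ^ T.p₀ ≤
      ENNReal.ofReal (2 * ε * T.N₀) ^ T.p₀ * ∫⁻ x in s, ‖f x‖ₑ ^ T.p₀ := by
  have hp0 : 0 < T.p₀ := zero_lt_one.trans T.one_lt_p₀
  have hfs : Measurable (s.indicator f) := hf.indicator hs
  have hbf : Measurable fun y => (b y - c) * s.indicator f y := by fun_prop
  have hTf := T.measurable_map _ hfs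
  have hTbf := T.measurable_map _ hbf
  have hnf : ∫⁻ x, ‖s.indicator f x‖ₑ ^ T.p₀ = ∫⁻ x in s, ‖f x‖ₑ ^ T.p₀ := by
    rw [← lintegral_indicator hs]
    congr 1
    ext x
    by_cases hx : x ∈ s <;> simp [hx, hp0]
  set u : Rd d → ℝ := fun x => s.indicator (fun y => b y - c) x * T.T (s.indicator f) x with hu
  have hum : Measurable u := ((hb.sub_const c).indicator hs).mul hTf
  set v : Rd d → ℝ := T.T fun y => (b y - c) * s.indicator f y with hv
  have hub : ∀ x, |u x| ≤ ε * |T.T (s.indicator f) x| := fun x => by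
    rw [hu, abs_mul]
    gcongr
    by_cases hx : x ∈ s
    · simpa [hx] using hbs x hx
    · simpa [hx] using hε
  have hvb : ∀ x, |(b x - c) * s.indicator f x| ≤ ε * |s.indicator f x| := fun x => by
    by_cases hx : x ∈ s
    · rw [abs_mul]
      gcongr
      exact hbs x hx
    · simp [hx]
  have hN : wnorm T.p₀ (fun _ => 1) (fun x => u x - v x) ≤
      ENNReal.ofReal (2 * ε * T.N₀) * wnorm T.p₀ (fun _ => 1) (s.indicator f) := by
    calc _ ≤ wnorm T.p₀ (fun _ => 1) u + wnorm T.p₀ (fun _ => 1) v :=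
          wnorm_sub_le T.one_lt_p₀.le measurable_const hum hTbf
      _ ≤ ENNReal.ofReal ε * (ENNReal.ofReal T.N₀ * wnorm T.p₀ (fun _ => 1) (s.indicator f))
          + ENNReal.ofReal T.N₀ * (ENNReal.ofReal ε * wnorm T.p₀ (fun _ => 1) (s.indicator f)) := by
          gcongr
          · exact (wnorm_le_mul hp0 hub).trans (by gcongr; exact T.bounded _ hfs)
          · exact (T.bounded _ hbf).trans (by gcongr; exact wnorm_le_mul hp0 hvb)
      _ = _ := by
          rw [ENNReal.ofReal_mul (by positivity), ENNReal.ofReal_mul zero_le_two,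
            ENNReal.ofReal_ofNat]
          ring
  rw [wnorm_one hp0, wnorm_one hp0, hnf] at hN
  calc _ = ∫⁻ x in s, ‖u x - v x‖ₑ ^ T.p₀ := by
        refine setLIntegral_congr_fun hs fun x hx => ?_
        simp only [commutatorOp_eq_sub_const T b c, hu, hv, Set.indicator_of_mem hx (fun y => b y - c)]
    _ ≤ ∫⁻ x, ‖u x - v x‖ₑ ^ T.p₀ := setLIntegral_le_lintegral _ _
    _ = ((∫⁻ x, ‖u x - v x‖ₑ ^ T.p₀) ^ (1 / T.p₀)) ^ T.p₀ := by
        rw [← ENNReal.rpow_mul, one_div_mul_cancel hp0.ne', ENNReal.rpow_one]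
    _ ≤ _ := ENNReal.rpow_le_rpow hN hp0.le
    _ = _ := by
        rw [ENNReal.mul_rpow_of_nonneg _ _ hp0.le, ← ENNReal.rpow_mul,
          one_div_mul_cancel hp0.ne', ENNReal.rpow_one]

lemma measurable_commMajorant_integrand {b f : Rd d → ℝ} (C : ℝ) (hb : Measurable b)
    (hf : Measurable f) : Measurable fun z : Rd d × Rd d =>
      ENNReal.ofReal (C * (|b z.1 - b z.2| / dist z.1 z.2 ^ d)) * ‖f z.2‖ₑ := by
  simp only [← Real.norm_eq_abs]
  fun_prop

lemma measurable_commMajorant {b f : Rd d → ℝ} (C : ℝ) (hb : Measurable b) (hf : Measurable f) :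
    Measurable (commMajorant C b f) :=
  (measurable_commMajorant_integrand C hb hf).lintegral_prod_right'

lemma commMajorant_indicator (C : ℝ) (b f : Rd d → ℝ) {s : Set (Rd d)} (hs : MeasurableSet s)
    (x : Rd d) : commMajorant C b (s.indicator f) x =
      ∫⁻ y in s, ENNReal.ofReal (C * (|b x - b y| / dist x y ^ d)) * ‖f y‖ₑ := by
  rw [commMajorant, ← lintegral_indicator hs]
  congr 1
  ext y
  by_cases hy : y ∈ s <;> simp [hy]

/-- The partition of the space obtained by disjointifying a sequence of balls. -/
def ballPart (z : ℕ → Rd d) (ε : ℝ) (n : ℕ) : Set (Rd d) :=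
  {x | x ∈ Metric.ball (z n) ε ∧ ∀ k < n, x ∉ Metric.ball (z k) ε}

lemma measurableSet_ballPart (z : ℕ → Rd d) (ε : ℝ) (n : ℕ) :
    MeasurableSet (ballPart z ε n) := by
  have : ballPart z ε n = Metric.ball (z n) ε ∩ ⋂ k, ⋂ (_ : k < n), (Metric.ball (z k) ε)ᶜ := by
    ext x
    simp [ballPart]
  rw [this]
  exact measurableSet_ball.inter
    (MeasurableSet.iInter fun k => MeasurableSet.iInter fun _ => measurableSet_ball.compl)

lemma pairwise_disjoint_ballPart (z : ℕ → Rd d) (ε : ℝ) :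
    Pairwise (Function.onFun Disjoint (ballPart z ε)) := by
  intro m n hmn
  rw [Function.onFun, Set.disjoint_left]
  intro x hm hn
  rcases lt_or_gt_of_ne hmn with h | h
  · exact hn.2 m h hm.1
  · exact hm.2 n h hn.1

lemma exists_mem_ballPart {z : ℕ → Rd d} {ε : ℝ} {x : Rd d} {n : ℕ}
    (hx : x ∈ Metric.ball (z n) ε) : ∃ m ≤ n, x ∈ ballPart z ε m := by
  classical
  have hex : ∃ n, x ∈ Metric.ball (z n) ε := ⟨n, hx⟩
  exact ⟨Nat.find hex, Nat.find_min' hex hx, Nat.find_spec hex, fun k hk => Nat.find_min hex hk⟩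

lemma mem_ballPart_of_mem_closure {z : ℕ → Rd d} {ε : ℝ} {x : Rd d} {n : ℕ}
    (hx : x ∈ closure (ballPart z ε n)) (hs : x ∉ Metric.sphere (z n) ε) :
    x ∈ ballPart z ε n := by
  have h1 : x ∈ Metric.closedBall (z n) ε :=
    closure_minimal (fun y hy => Metric.ball_subset_closedBall hy.1) Metric.isClosed_closedBall hx
  refine ⟨?_, fun k hk => ?_⟩
  · rw [Metric.mem_ball]
    exact lt_of_le_of_ne h1 hs
  · exact closure_minimal (t := (Metric.ball (z k) ε)ᶜ) (fun y hy => hy.2 k hk)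
      Metric.isOpen_ball.isClosed_compl hx

lemma lintegral_enorm_commutatorOp_sub_le (hd : 0 < d) {ω : ℝ → ℝ} (hω : ModulusOfContinuity ω)
    (T : CZOperator d ω) {b : Rd d → ℝ} (hb : LipschitzWith 1 b) (hb1 : ∀ x, |b x| ≤ 1)
    {f : Rd d → ℝ} (hf : BddCompactSupp f) {ε : ℝ} (hε : 0 < ε) :
    ∫⁻ x, (‖commutatorOp b T.T f x‖ₑ - commMajorant T.CK b f x) ^ T.p₀ ≤
      ENNReal.ofReal (2 * ε * T.N₀) ^ T.p₀ * ∫⁻ x, ‖f x‖ₑ ^ T.p₀ := by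
  have : Nonempty (Fin d) := ⟨⟨0, hd⟩⟩
  have hbm : Measurable b := hb.continuous.measurable
  have hp0 : 0 < T.p₀ := zero_lt_one.trans T.one_lt_p₀
  let z : ℕ → Rd d := TopologicalSpace.denseSeq (Rd d)
  let P := ballPart z ε
  have hPm : ∀ n, MeasurableSet (P n) := measurableSet_ballPart z ε
  have hPd : Pairwise (Function.onFun Disjoint P) := pairwise_disjoint_ballPart z ε
  have hcover : ∀ x, ∃ n, x ∈ Metric.ball (z n) ε := fun x => by
    obtain ⟨n, hn⟩ := (TopologicalSpace.denseRange_denseSeq (Rd d)).exists_dist_lt x hε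
    exact ⟨n, hn⟩
  have hPU : ⋃ n, P n = Set.univ := Set.eq_univ_of_forall fun x => by
    obtain ⟨n, hn⟩ := hcover x
    obtain ⟨m, -, hm⟩ := exists_mem_ballPart hn
    exact Set.mem_iUnion.2 ⟨m, hm⟩
  obtain ⟨N, hN⟩ : ∃ N, ∀ x ∈ tsupport f, ∃ m < N, x ∈ P m := by
    obtain ⟨t, ht⟩ := hf.2.1.isCompact.elim_finite_subcover (fun n => Metric.ball (z n) ε)
      (fun _ => Metric.isOpen_ball) fun x _ => Set.mem_iUnion.2 (hcover x)
    refine ⟨t.sup id + 1, fun x hx => ?_⟩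
    obtain ⟨n, hnt, hn⟩ := Set.mem_iUnion₂.1 (ht hx)
    obtain ⟨m, hmn, hm⟩ := exists_mem_ballPart hn
    exact ⟨m, Nat.lt_succ_of_le (hmn.trans (Finset.le_sup (f := id) hnt)), hm⟩
  have hsum : f = ∑ m ∈ Finset.range N, (P m).indicator f := by
    ext x
    rw [Finset.sum_apply]
    by_cases hx : x ∈ tsupport f
    · obtain ⟨m, hm, hxm⟩ := hN x hx
      rw [Finset.sum_eq_single m, Set.indicator_of_mem hxm]
      · intro k _ hk
        exact Set.indicator_of_notMem (Set.disjoint_right.1 (hPd hk) hxm) _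
      · exact fun h => absurd (Finset.mem_range.2 hm) h
    · have h0 : f x = 0 := image_eq_zero_of_notMem_tsupport hx
      rw [h0]
      refine (Finset.sum_eq_zero fun m _ => ?_).symm
      by_cases hm : x ∈ P m <;> simp [hm, h0]
  have hsphere : ∀ᵐ x : Rd d, ∀ n, x ∉ Metric.sphere (z n) ε :=
    ae_all_iff.2 fun n => measure_eq_zero_iff_ae_notMem.1 (Measure.addHaar_sphere volume _ _)
  have hpoint : ∀ᵐ x : Rd d, ∀ n, x ∈ P n →
      ‖commutatorOp b T.T f x‖ₑ - commMajorant T.CK b f x ≤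
        ‖commutatorOp b T.T ((P n).indicator f) x‖ₑ := by
    filter_upwards [hsphere] with x hx n hxn
    rw [tsub_le_iff_right]
    have hterm : ∀ m, ‖commutatorOp b T.T ((P m).indicator f) x‖ₑ ≤
        (if m = n then ‖commutatorOp b T.T ((P n).indicator f) x‖ₑ else 0) +
          commMajorant T.CK b ((P m).indicator f) x := by
      intro m
      by_cases hmn : m = n
      · simp [hmn]
      · rw [if_neg hmn, zero_add]
        refine enorm_commutatorOp_le_of_notMem_tsupport hω T hbm hb1 (hf.indicator (hPm m)) ?_
        intro hxt
        have hxm : x ∈ P m := mem_ballPart_of_mem_closure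
          (closure_mono Set.support_indicator_subset hxt) (hx m)
        exact Set.disjoint_left.1 (hPd hmn) hxm hxn
    calc ‖commutatorOp b T.T f x‖ₑ
        = ‖∑ m ∈ Finset.range N, commutatorOp b T.T ((P m).indicator f) x‖ₑ := by
          rw [← T.commutatorOp_sum, ← hsum]
      _ ≤ ∑ m ∈ Finset.range N, ‖commutatorOp b T.T ((P m).indicator f) x‖ₑ := enorm_sum_le _ _
      _ ≤ ∑ m ∈ Finset.range N,
          ((if m = n then ‖commutatorOp b T.T ((P n).indicator f) x‖ₑ else 0) +
            commMajorant T.CK b ((P m).indicator f) x) := Finset.sum_le_sum fun m _ => hterm m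
      _ ≤ _ := by
          rw [Finset.sum_add_distrib]
          gcongr
          · rw [Finset.sum_ite_eq' (Finset.range N) n]
            split_ifs <;> simp
          · simp only [commMajorant_indicator _ _ _ (hPm _)]
            refine (ENNReal.sum_le_tsum _).trans_eq ?_
            rw [← lintegral_iUnion hPm hPd, hPU, setLIntegral_univ, commMajorant]
  calc _ = ∑' n, ∫⁻ x in P n,
        (‖commutatorOp b T.T f x‖ₑ - commMajorant T.CK b f x) ^ T.p₀ := by
        rw [← lintegral_iUnion hPm hPd, hPU, setLIntegral_univ]
    _ ≤ ∑' n, ∫⁻ x in P n, ‖commutatorOp b T.T ((P n).indicator f) x‖ₑ ^ T.p₀ := by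
        refine ENNReal.tsum_le_tsum fun n => setLIntegral_mono_ae' (hPm n) ?_
        filter_upwards [hpoint] with x hx hxn
        exact ENNReal.rpow_le_rpow (hx n hxn) hp0.le
    _ ≤ ∑' n, ENNReal.ofReal (2 * ε * T.N₀) ^ T.p₀ * ∫⁻ x in P n, ‖f x‖ₑ ^ T.p₀ := by
        refine ENNReal.tsum_le_tsum fun n => lintegral_commutatorOp_indicator_le T hbm hf.1 (hPm n)
          (c := b (z n)) hε.le fun x hx => ?_
        have h := hb.dist_le_mul x (z n)
        rw [NNReal.coe_one, one_mul, Real.dist_eq] at h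
        exact h.trans hx.1.le
    _ = _ := by
        rw [ENNReal.tsum_mul_left, ← lintegral_iUnion hPm hPd, hPU, setLIntegral_univ]

/-- Pointwise domination of the commutator with a Lipschitz symbol by a positive operator. -/
lemma ae_enorm_commutatorOp_le (hd : 0 < d) {ω : ℝ → ℝ} (hω : ModulusOfContinuity ω)
    (T : CZOperator d ω) {b : Rd d → ℝ} (hb : LipschitzWith 1 b) (hb1 : ∀ x, |b x| ≤ 1)
    {f : Rd d → ℝ} (hf : BddCompactSupp f) :
    ∀ᵐ x, ‖commutatorOp b T.T f x‖ₑ ≤ commMajorant T.CK b f x := by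
  have hbm : Measurable b := hb.continuous.measurable
  have hp0 : 0 < T.p₀ := zero_lt_one.trans T.one_lt_p₀
  have hfin : ∫⁻ x, ‖f x‖ₑ ^ T.p₀ ≠ ⊤ := by
    obtain ⟨M, hM⟩ := hf.2.2
    have hle : ∀ x, ‖f x‖ₑ ^ T.p₀ ≤
        (tsupport f).indicator (fun _ => ENNReal.ofReal M ^ T.p₀) x := fun x => by
      by_cases hx : x ∈ tsupport f
      · rw [Set.indicator_of_mem hx, Real.enorm_eq_ofReal_abs]
        gcongr
        exact hM x
      · simp [image_eq_zero_of_notMem_tsupport hx, hp0]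
    refine ((lintegral_mono hle).trans_lt ?_).ne
    rw [lintegral_indicator_const (isClosed_tsupport f).measurableSet]
    exact ENNReal.mul_lt_top (ENNReal.rpow_lt_top_of_nonneg hp0.le ENNReal.ofReal_ne_top)
      hf.2.1.isCompact.measure_lt_top
  have hcomm : Measurable (commutatorOp b T.T f) :=
    (hbm.mul (T.measurable_map f hf.1)).sub (T.measurable_map _ (hbm.mul hf.1))
  have hmaj := measurable_commMajorant T.CK hbm hf.1
  have hlim : Tendsto (fun ε : ℝ => ENNReal.ofReal (2 * ε * T.N₀) ^ T.p₀ * ∫⁻ x, ‖f x‖ₑ ^ T.p₀)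
      (nhdsWithin 0 (Ioi 0)) (nhds 0) := by
    have h0 : Tendsto (fun ε : ℝ => 2 * ε * T.N₀) (nhdsWithin 0 (Ioi 0)) (nhds 0) := by
      have : Continuous fun ε : ℝ => 2 * ε * T.N₀ := by fun_prop
      simpa using (this.tendsto 0).mono_left nhdsWithin_le_nhds
    have h1 := (ENNReal.tendsto_ofReal h0).ennrpow_const T.p₀
    rw [ENNReal.ofReal_zero, ENNReal.zero_rpow_of_pos hp0] at h1
    simpa using ENNReal.Tendsto.mul_const h1 (Or.inr hfin)
  have hzero : ∫⁻ x, (‖commutatorOp b T.T f x‖ₑ - commMajorant T.CK b f x) ^ T.p₀ = 0 := by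
    refine le_antisymm (ge_of_tendsto hlim ?_) zero_le
    filter_upwards [self_mem_nhdsWithin] with ε hε
    exact lintegral_enorm_commutatorOp_sub_le hd hω T hb hb1 hf hε
  rw [lintegral_eq_zero_iff (by fun_prop)] at hzero
  filter_upwards [hzero] with x hx
  have h := (ENNReal.rpow_eq_zero_iff_of_pos hp0).1 hx
  exact tsub_eq_zero_iff_le.1 h

/-- A Lipschitz cutoff: one on the unit ball, zero off the ball of radius two. -/
def cutoff (x : Rd d) : ℝ := max (min (2 - ‖x‖) 1) 0

lemma lipschitzWith_cutoff : LipschitzWith 1 (cutoff : Rd d → ℝ) := by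
  refine LipschitzWith.of_dist_le_mul fun x y => ?_
  rw [NNReal.coe_one, one_mul, Real.dist_eq, cutoff, cutoff]
  refine (abs_max_sub_max_le_abs _ _ _).trans ((abs_min_sub_min_le_max _ _ _ _).trans ?_)
  rw [sub_self, abs_zero, max_eq_left (abs_nonneg _), dist_eq_norm,
    show 2 - ‖x‖ - (2 - ‖y‖) = ‖y‖ - ‖x‖ by ring, abs_sub_comm]
  exact abs_norm_sub_norm_le x y

lemma cutoff_nonneg (x : Rd d) : 0 ≤ cutoff x := le_max_right _ _

lemma cutoff_le_one (x : Rd d) : cutoff x ≤ 1 := max_le (min_le_right _ _) zero_le_one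

lemma abs_cutoff_le_one (x : Rd d) : |cutoff x| ≤ 1 := by
  rw [abs_of_nonneg (cutoff_nonneg x)]
  exact cutoff_le_one x

lemma cutoff_of_norm_le_one {x : Rd d} (hx : ‖x‖ ≤ 1) : cutoff x = 1 := by
  rw [cutoff, min_eq_right (by linarith), max_eq_left zero_le_one]

lemma cutoff_of_two_le_norm {x : Rd d} (hx : 2 ≤ ‖x‖) : cutoff x = 0 := by
  rw [cutoff, max_eq_right ((min_le_left _ _).trans (by linarith))]

lemma measurable_cutoff : Measurable (cutoff : Rd d → ℝ) :=
  lipschitzWith_cutoff.continuous.measurable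

/-- The local part of the commutator kernel. -/
def localKernel (z : Rd d) : ℝ≥0∞ :=
  (Metric.ball 0 (1 / 2)).indicator (fun z => ENNReal.ofReal (‖z‖ ^ (-((d : ℝ) - 1)))) z

/-- The decaying factor `(1 + ‖x‖)⁻ᵈ` of the global part of the commutator kernel. -/
def decay (x : Rd d) : ℝ≥0∞ := ENNReal.ofReal ((1 + ‖x‖) ^ (-(d : ℝ)))

/-- The annulus on which the local part of the commutator kernel lives. -/
def annulus : Set (Rd d) := {x | 1 / 2 ≤ ‖x‖ ∧ ‖x‖ ≤ 3}

lemma measurable_localKernel : Measurable (localKernel : Rd d → ℝ≥0∞) := by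
  unfold localKernel
  exact Measurable.indicator (by fun_prop) measurableSet_ball

lemma measurable_decay : Measurable (decay : Rd d → ℝ≥0∞) := by
  unfold decay
  fun_prop

lemma measurableSet_annulus : MeasurableSet (annulus : Set (Rd d)) :=
  (measurableSet_le measurable_const measurable_norm).inter
    (measurableSet_le measurable_norm measurable_const)

lemma ofReal_commKernel_le (x y : Rd d) :
    ENNReal.ofReal (|cutoff x - cutoff y| / dist x y ^ d) ≤
      21 ^ d * decay x * decay y + annulus.indicator (fun _ => localKernel (x - y)) x := by
  by_cases hb : cutoff x = cutoff y
  · simp [hb]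
  have hxy : x ≠ y := fun h => hb (by rw [h])
  have hpos : 0 < dist x y := dist_pos.2 hxy
  have h1 := norm_sub_norm_le x y
  have h2 := norm_sub_norm_le y x
  rw [norm_sub_rev] at h2
  rw [← dist_eq_norm] at h1 h2
  have hx0 := norm_nonneg x
  have hy0 := norm_nonneg y
  by_cases hfar : 1 / 2 ≤ dist x y
  · refine le_add_right ?_
    have hmin : ‖x‖ ≤ 2 ∨ ‖y‖ ≤ 2 := by
      by_contra! h
      exact hb (by rw [cutoff_of_two_le_norm h.1.le, cutoff_of_two_le_norm h.2.le])
    have hprod : (1 + ‖x‖) * (1 + ‖y‖) ≤ 21 * dist x y := by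
      rcases hmin with h | h <;> nlinarith
    have hdiff : |cutoff x - cutoff y| ≤ 1 := by
      rw [abs_le]
      have := cutoff_nonneg x
      have := cutoff_nonneg y
      have := cutoff_le_one x
      have := cutoff_le_one y
      constructor <;> linarith
    have hreal : |cutoff x - cutoff y| / dist x y ^ d ≤
        21 ^ d * (1 + ‖x‖) ^ (-(d : ℝ)) * (1 + ‖y‖) ^ (-(d : ℝ)) := by
      rw [Real.rpow_neg (by positivity), Real.rpow_neg (by positivity), Real.rpow_natCast,
        Real.rpow_natCast, mul_assoc, ← mul_inv, ← mul_pow, ← div_eq_mul_inv,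
        div_le_div_iff₀ (by positivity) (by positivity), ← mul_pow]
      exact (mul_le_of_le_one_left (by positivity) hdiff).trans (by gcongr)
    refine (ENNReal.ofReal_le_ofReal hreal).trans_eq ?_
    rw [ENNReal.ofReal_mul (by positivity), ENNReal.ofReal_mul (by positivity),
      ENNReal.ofReal_pow (by positivity), ENNReal.ofReal_ofNat, decay, decay]
  · rw [not_le] at hfar
    refine le_add_left ?_
    have hx : x ∈ annulus := by
      constructor
      · by_contra! h
        exact hb (by rw [cutoff_of_norm_le_one (by linarith), cutoff_of_norm_le_one (by linarith)])
      · by_contra! h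
        exact hb (by rw [cutoff_of_two_le_norm (by linarith), cutoff_of_two_le_norm (by linarith)])
    rw [Set.indicator_of_mem hx, localKernel,
      Set.indicator_of_mem (by simpa [dist_eq_norm] using hfar)]
    apply ENNReal.ofReal_le_ofReal
    have hlip : |cutoff x - cutoff y| ≤ dist x y := by
      simpa [Real.dist_eq] using lipschitzWith_cutoff.dist_le_mul x y
    rw [← dist_eq_norm, neg_sub, Real.rpow_sub hpos, Real.rpow_one, Real.rpow_natCast]
    gcongr

lemma commMajorant_cutoff_le {C : ℝ} (hC : 0 ≤ C) {f : Rd d → ℝ} (hf : Measurable f) (x : Rd d) :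
    commMajorant C cutoff f x ≤
      (ENNReal.ofReal C * 21 ^ d * ∫⁻ y, decay y * ‖f y‖ₑ) * decay x +
      ENNReal.ofReal C * annulus.indicator (fun x => ∫⁻ y, localKernel (x - y) * ‖f y‖ₑ) x := by
  have hm1 : Measurable fun y => decay y * ‖f y‖ₑ := measurable_decay.mul hf.enorm
  have hm2 : Measurable fun y => localKernel (x - y) * ‖f y‖ₑ :=
    (measurable_localKernel.comp (measurable_const.sub measurable_id)).mul hf.enorm
  calc commMajorant C cutoff f x
      ≤ ∫⁻ y, ((ENNReal.ofReal C * 21 ^ d * decay x) * (decay y * ‖f y‖ₑ) +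
          ENNReal.ofReal C * annulus.indicator (fun _ => localKernel (x - y) * ‖f y‖ₑ) x) := by
        refine lintegral_mono fun y => ?_
        rw [ENNReal.ofReal_mul hC]
        calc _ ≤ ENNReal.ofReal C * (21 ^ d * decay x * decay y +
              annulus.indicator (fun _ => localKernel (x - y)) x) * ‖f y‖ₑ := by
              gcongr
              exact ofReal_commKernel_le x y
          _ = _ := by
              by_cases hx : x ∈ annulus <;> simp only [hx, Set.indicator_of_mem,
                Set.indicator_of_notMem, not_false_eq_true] <;> ring
    _ = _ := by
        rw [lintegral_add_left (hm1.const_mul _), lintegral_const_mul _ hm1]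
        by_cases hx : x ∈ annulus
        · simp only [hx, Set.indicator_of_mem]
          rw [lintegral_const_mul _ hm2]
          ring
        · simp only [hx, Set.indicator_of_notMem, not_false_eq_true, mul_zero, lintegral_zero]
          ring

/-- Young's inequality for the convolution with an integrable kernel. -/
lemma lintegral_conv_rpow_le {p : ℝ} (hp : 1 < p) {H F : Rd d → ℝ≥0∞} (hH : Measurable H)
    (hF : Measurable F) :
    ∫⁻ x, (∫⁻ y, H (x - y) * F y) ^ p ≤ (∫⁻ x, H x) ^ p * ∫⁻ y, F y ^ p := by
  have hp0 : 0 < p := by linarith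
  have hpq := Real.HolderConjugate.conjExponent hp
  set p' := p.conjExponent
  have hp'0 : 0 < p' := hpq.symm.pos
  have hHm : Measurable fun z : Rd d × Rd d => H (z.1 - z.2) :=
    hH.comp (measurable_fst.sub measurable_snd)
  have hpoint : ∀ x, (∫⁻ y, H (x - y) * F y) ^ p ≤
      (∫⁻ x, H x) ^ (p - 1) * ∫⁻ y, H (x - y) * F y ^ p := by
    intro x
    have hHx : Measurable fun y => H (x - y) := hH.comp (measurable_const.sub measurable_id)
    have h := ENNReal.lintegral_mul_le_Lp_mul_Lq volume hpq.symm
      (f := fun y => H (x - y) ^ (1 / p')) (g := fun y => H (x - y) ^ (1 / p) * F y)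
      (hHx.pow_const _).aemeasurable ((hHx.pow_const _).mul hF).aemeasurable
    have hsplit : ∀ y, ((fun y => H (x - y) ^ (1 / p')) * fun y => H (x - y) ^ (1 / p) * F y) y =
        H (x - y) * F y := fun y => by
      rw [Pi.mul_apply, ← mul_assoc, ← ENNReal.rpow_add_of_nonneg _ _ (by positivity)
        (by positivity), one_div, one_div, hpq.symm.inv_add_inv_eq_one, ENNReal.rpow_one]
    simp only [hsplit, ENNReal.mul_rpow_of_nonneg _ _ hp0.le, ← ENNReal.rpow_mul,
      one_div_mul_cancel hp0.ne', one_div_mul_cancel hp'0.ne', ENNReal.rpow_one,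
      lintegral_sub_left_eq_self H x] at h
    refine (ENNReal.rpow_le_rpow h hp0.le).trans_eq ?_
    rw [ENNReal.mul_rpow_of_nonneg _ _ hp0.le, ← ENNReal.rpow_mul, ← ENNReal.rpow_mul,
      one_div_mul_cancel hp0.ne', ENNReal.rpow_one]
    congr 2
    rw [one_div, inv_mul_eq_div, hpq.div_conj_eq_sub_one]
  calc _ ≤ ∫⁻ x, (∫⁻ x, H x) ^ (p - 1) * ∫⁻ y, H (x - y) * F y ^ p := lintegral_mono hpoint
    _ = (∫⁻ x, H x) ^ (p - 1) * ∫⁻ y, ∫⁻ x, H (x - y) * F y ^ p := by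
        have hm : Measurable fun z : Rd d × Rd d => H (z.1 - z.2) * F z.2 ^ p := by fun_prop
        rw [lintegral_const_mul _ hm.lintegral_prod_right',
          lintegral_lintegral_swap hm.aemeasurable]
    _ = (∫⁻ x, H x) ^ (p - 1) * ∫⁻ y, (∫⁻ x, H x) * F y ^ p := by
        congr 2
        ext y
        have hHy : Measurable fun x => H (x - y) := hH.comp (measurable_id.sub_const y)
        rw [lintegral_mul_const _ hHy,
          lintegral_sub_right_eq_self H y]
    _ = _ := by
        rw [lintegral_const_mul _ (hF.pow_const _), ← mul_assoc]
        congr 1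
        nth_rewrite 2 [← ENNReal.rpow_one (∫⁻ x, H x)]
        rw [← ENNReal.rpow_add_of_nonneg _ _ (by linarith) zero_le_one, sub_add_cancel]

lemma lintegral_const_mul_rpow {q : ℝ} (hq : 0 < q) (c : ℝ≥0∞) {g : Rd d → ℝ≥0∞}
    (hg : Measurable g) :
    (∫⁻ x, (c * g x) ^ q) ^ (1 / q) = c * (∫⁻ x, g x ^ q) ^ (1 / q) := by
  simp only [ENNReal.mul_rpow_of_nonneg _ _ hq.le]
  rw [lintegral_const_mul _ (hg.pow_const q), ENNReal.mul_rpow_of_nonneg _ _ (by positivity),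
    ← ENNReal.rpow_mul, mul_one_div_cancel hq.ne', ENNReal.rpow_one]

lemma setLIntegral_norm_rpow_lt_top (hd : 0 < d) {α : ℝ} (hα : α < d) (R : ℝ) :
    ∫⁻ x in Metric.ball (0 : Rd d) R, ENNReal.ofReal (‖x‖ ^ (-α)) < ⊤ := by
  have h := ((locallyIntegrable_norm_rpow hd hα).integrableOn_isCompact
    (isCompact_closedBall (0 : Rd d) R)).mono_set Metric.ball_subset_closedBall
  have h2 := h.hasFiniteIntegral
  rwa [hasFiniteIntegral_iff_ofReal (.of_forall fun x => by positivity)] at h2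

lemma lintegral_localKernel_lt_top (hd : 0 < d) :
    ∫⁻ x, (localKernel x : ℝ≥0∞) ∂(volume : Measure (Rd d)) < ⊤ := by
  unfold localKernel
  rw [lintegral_indicator measurableSet_ball]
  exact setLIntegral_norm_rpow_lt_top hd (by linarith) _

lemma decay_rpow {r : ℝ} (hr : 0 ≤ r) (x : Rd d) :
    decay x ^ r = ENNReal.ofReal ((1 + ‖x‖) ^ (-((d : ℝ) * r))) := by
  rw [decay, ENNReal.ofReal_rpow_of_nonneg (by positivity) hr, ← Real.rpow_mul (by positivity),
    neg_mul]

lemma lintegral_decay_rpow_lt_top (hd : 0 < d) {r : ℝ} (hr : 1 < r) :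
    ∫⁻ x : Rd d, decay x ^ r < ⊤ := by
  simp only [decay_rpow (zero_le_one.trans hr.le)]
  apply finite_integral_one_add_norm
  rw [finrank_euclideanSpace, Fintype.card_fin]
  exact lt_mul_of_one_lt_right (by exact_mod_cast hd) hr

lemma lintegral_decay_rpow_mul_singWeight_lt_top (hd : 0 < d) {α : ℝ} (hα0 : 0 ≤ α) (hα : α < d)
    {q : ℝ} (hq : 1 < q) :
    ∫⁻ x : Rd d, decay x ^ q * ENNReal.ofReal (singWeight α x) < ⊤ := by
  have hq0 : 0 ≤ q := by linarith
  have hle : ∀ x : Rd d, decay x ^ q * ENNReal.ofReal (singWeight α x) ≤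
      2 * decay x ^ q +
        (Metric.ball 0 1).indicator (fun x => ENNReal.ofReal (‖x‖ ^ (-α))) x := by
    intro x
    have h1 : decay x ^ q ≤ 1 := by
      rw [decay_rpow hq0, ENNReal.ofReal_le_one]
      exact Real.rpow_le_one_of_one_le_of_nonpos (by linarith [norm_nonneg x])
        (neg_nonpos.2 (by positivity))
    rw [singWeight, ENNReal.ofReal_add zero_le_one (by positivity), ENNReal.ofReal_one, mul_add,
      mul_one, two_mul]
    by_cases hx : x ∈ Metric.ball (0 : Rd d) 1
    · rw [Set.indicator_of_mem hx]
      exact add_le_add le_self_add (mul_le_of_le_one_left' h1)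
    · rw [Set.indicator_of_notMem hx, add_zero]
      refine add_le_add le_rfl (mul_le_of_le_one_right' ?_)
      rw [ENNReal.ofReal_le_one]
      exact Real.rpow_le_one_of_one_le_of_nonpos (by simpa using hx) (neg_nonpos.2 hα0)
  refine (lintegral_mono hle).trans_lt ?_
  rw [lintegral_add_left ((measurable_decay.pow_const q).const_mul 2),
    lintegral_const_mul _ (measurable_decay.pow_const q), lintegral_indicator measurableSet_ball]
  exact ENNReal.add_lt_top.2 ⟨ENNReal.mul_lt_top (by simp) (lintegral_decay_rpow_lt_top hd hq),
    setLIntegral_norm_rpow_lt_top hd hα 1⟩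

lemma singWeight_le_of_mem_annulus {α : ℝ} (hα : 0 ≤ α) {x : Rd d} (hx : x ∈ annulus) :
    singWeight α x ≤ 1 + 2 ^ α := by
  rw [singWeight, Real.rpow_neg (norm_nonneg x), ← Real.inv_rpow (norm_nonneg x)]
  gcongr
  rw [inv_le_comm₀ (by linarith [hx.1]) two_pos]
  simpa using hx.1

lemma volume_annulus_lt_top : volume (annulus : Set (Rd d)) < ⊤ :=
  (measure_mono fun x hx => by simpa using hx.2).trans_lt
    (measure_closedBall_lt_top (x := (0 : Rd d)) (r := 3))

/-- The pointwise majorant of the commutator is bounded from `L^p` to `L^q(singWeight α)`. -/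
lemma exists_lintegral_commMajorant_cutoff_le (hd : 0 < d) {p q α C : ℝ} (hC : 0 ≤ C)
    (hα0 : 0 ≤ α) (hα : α < d) (hq : 1 < q) (hqp : q ≤ p) :
    ∃ K : ℝ≥0∞, K ≠ ⊤ ∧ ∀ f : Rd d → ℝ, Measurable f →
      (∫⁻ x, (commMajorant C cutoff f x * ENNReal.ofReal (singWeight α x) ^ (1 / q)) ^ q) ^ (1 / q)
        ≤ K * (∫⁻ x, ‖f x‖ₑ ^ p) ^ (1 / p) := by
  have hq0 : 0 < q := by linarith
  have hp : 1 < p := hq.trans_le hqp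
  have hp0 : 0 < p := by linarith
  have hpq := Real.HolderConjugate.conjExponent hp
  set p' := p.conjExponent
  have hp' : 1 < p' := hpq.symm.lt
  set u : Rd d → ℝ≥0∞ := fun x => ENNReal.ofReal (singWeight α x) ^ (1 / q) with hu
  have hum : Measurable u := (measurable_singWeight α).ennreal_ofReal.pow_const _
  set B : ℝ≥0∞ := ENNReal.ofReal C * ENNReal.ofReal (1 + 2 ^ α) ^ (1 / q) with hB
  set D : ℝ≥0∞ := (∫⁻ x : Rd d, decay x ^ p') ^ (1 / p')
  set E : ℝ≥0∞ := (∫⁻ x : Rd d, (decay x * u x) ^ q) ^ (1 / q)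
  set L : ℝ≥0∞ := ∫⁻ x, (localKernel x : ℝ≥0∞) ∂(volume : Measure (Rd d))
  set V : ℝ≥0∞ := volume (annulus : Set (Rd d)) ^ (1 / q - 1 / p)
  have hD : D ≠ ⊤ := ENNReal.rpow_ne_top_of_nonneg (by positivity)
    (lintegral_decay_rpow_lt_top hd hp').ne
  have hE : E ≠ ⊤ := by
    refine ENNReal.rpow_ne_top_of_nonneg (by positivity) ?_
    simp only [hu, ENNReal.mul_rpow_of_nonneg _ _ hq0.le, ← ENNReal.rpow_mul,
      one_div_mul_cancel hq0.ne', ENNReal.rpow_one]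
    exact (lintegral_decay_rpow_mul_singWeight_lt_top hd hα0 hα hq).ne
  have hL : L ≠ ⊤ := (lintegral_localKernel_lt_top hd).ne
  have hV : V ≠ ⊤ := ENNReal.rpow_ne_top_of_nonneg
    (sub_nonneg.2 (one_div_le_one_div_of_le hq0 hqp)) volume_annulus_lt_top.ne
  have hBt : B ≠ ⊤ := ENNReal.mul_ne_top ENNReal.ofReal_ne_top
    (ENNReal.rpow_ne_top_of_nonneg (by positivity) ENNReal.ofReal_ne_top)
  refine ⟨ENNReal.ofReal C * 21 ^ d * D * E + B * (L * V), by finiteness, fun f hf => ?_⟩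
  set F : ℝ≥0∞ := (∫⁻ x, ‖f x‖ₑ ^ p) ^ (1 / p)
  set A : ℝ≥0∞ := ENNReal.ofReal C * 21 ^ d * ∫⁻ y, decay y * ‖f y‖ₑ with hA
  set J : Rd d → ℝ≥0∞ := fun x => ∫⁻ y, localKernel (x - y) * ‖f y‖ₑ
  have hJm : Measurable J := by
    have : Measurable fun z : Rd d × Rd d => localKernel (z.1 - z.2) * ‖f z.2‖ₑ :=
      (measurable_localKernel.comp (measurable_fst.sub measurable_snd)).mul
        (hf.enorm.comp measurable_snd)
    exact this.lintegral_prod_right'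
  have hglobal : ∫⁻ y, decay y * ‖f y‖ₑ ≤ D * F :=
    ENNReal.lintegral_mul_le_Lp_mul_Lq volume hpq.symm measurable_decay.aemeasurable
      hf.enorm.aemeasurable
  have hlocal : (∫⁻ x, annulus.indicator J x ^ q) ^ (1 / q) ≤ L * V * F := by
    have h1 : ∫⁻ x, annulus.indicator J x ^ q = ∫⁻ x in annulus, J x ^ q := by
      rw [← lintegral_indicator measurableSet_annulus]
      congr 1
      ext x
      by_cases hx : x ∈ annulus <;> simp [hx, hq0]
    have h2 := eLpNorm'_le_eLpNorm'_mul_rpow_measure_univ (μ := volume.restrict annulus) hq0 hqp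
      hJm.aestronglyMeasurable
    simp only [eLpNorm', enorm_eq_self, Measure.restrict_apply_univ] at h2
    rw [h1]
    refine h2.trans ?_
    rw [mul_right_comm]
    refine mul_le_mul_left ?_ _
    calc (∫⁻ x in annulus, J x ^ p) ^ (1 / p) ≤ (L ^ p * ∫⁻ y, ‖f y‖ₑ ^ p) ^ (1 / p) := by
          gcongr
          exact (setLIntegral_le_lintegral _ _).trans
            (lintegral_conv_rpow_le hp measurable_localKernel hf.enorm)
      _ = L * F := by
          rw [ENNReal.mul_rpow_of_nonneg _ _ (by positivity), ← ENNReal.rpow_mul,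
            mul_one_div_cancel hp0.ne', ENNReal.rpow_one]
  have hpoint : ∀ x, commMajorant C cutoff f x * u x ≤
      ((fun x => A * (decay x * u x)) + fun x => B * annulus.indicator J x) x := fun x => by
    refine (mul_le_mul_left (commMajorant_cutoff_le hC hf x) _).trans ?_
    rw [add_mul, Pi.add_apply, mul_assoc]
    refine add_le_add le_rfl ?_
    by_cases hx : x ∈ annulus
    · simp only [hx, Set.indicator_of_mem]
      rw [mul_right_comm, hB, hu]
      beta_reduce
      gcongr
      exact singWeight_le_of_mem_annulus hα0 hx
    · simp [hx]
  calc _ ≤ (∫⁻ x, (((fun x => A * (decay x * u x)) + fun x => B * annulus.indicator J x) x) ^ q)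
          ^ (1 / q) := by
        gcongr with x
        exact hpoint x
    _ ≤ (∫⁻ x, (A * (decay x * u x)) ^ q) ^ (1 / q) +
          (∫⁻ x, (B * annulus.indicator J x) ^ q) ^ (1 / q) :=
        ENNReal.lintegral_Lp_add_le ((measurable_decay.mul hum).const_mul A).aemeasurable
          ((hJm.indicator measurableSet_annulus).const_mul B).aemeasurable hq.le
    _ = A * E + B * (∫⁻ x, annulus.indicator J x ^ q) ^ (1 / q) := by
        rw [← lintegral_const_mul_rpow hq0 B (hJm.indicator measurableSet_annulus)]
        exact congrArg (· + _) (lintegral_const_mul_rpow hq0 A (measurable_decay.mul hum))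
    _ ≤ ENNReal.ofReal C * 21 ^ d * (D * F) * E + B * (L * V * F) := by
        rw [hA]
        gcongr
    _ = _ := by ring

lemma exists_opBoundCS_commutatorOp_cutoff (hd : 0 < d) {ω : ℝ → ℝ} (hω : ModulusOfContinuity ω)
    (T : CZOperator d ω) {p q α : ℝ} (hα0 : 0 ≤ α) (hα : α < d) (hq : 1 < q) (hqp : q ≤ p) :
    ∃ N : ℝ, 0 ≤ N ∧
      OpBoundCS p q (fun _ => 1) (singWeight α) (commutatorOp cutoff T.T) N := by
  obtain ⟨K, hK, h⟩ := exists_lintegral_commMajorant_cutoff_le hd T.CK_pos.le hα0 hα hq hqp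
  refine ⟨K.toReal, ENNReal.toReal_nonneg, fun f hf => ?_⟩
  have hq0 : 0 < q := by linarith
  rw [ENNReal.ofReal_toReal hK, wnorm_one (hq0.trans_le hqp), wnorm_eq hq0]
  refine le_trans ?_ (h f hf.1)
  refine ENNReal.rpow_le_rpow (lintegral_mono_ae ?_) (by positivity)
  filter_upwards [ae_enorm_commutatorOp_le hd hω T lipschitzWith_cutoff abs_cutoff_le_one hf]
    with x hx
  gcongr

lemma bddCompactSupp_indicator_ball (z : Rd d) (R : ℝ) :
    BddCompactSupp ((Metric.ball z R).indicator fun _ => (1 : ℝ)) := by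
  refine ⟨measurable_const.indicator measurableSet_ball, ?_, 1, fun x => ?_⟩
  · refine HasCompactSupport.intro (isCompact_closedBall z R) fun x hx => ?_
    exact Set.indicator_of_notMem (fun h => hx (Metric.ball_subset_closedBall h)) _
  · by_cases hx : x ∈ Metric.ball z R <;> simp [hx]

/-- Testing a multiplication operator on the indicator of a ball. -/
lemma mul_rpow_le_of_opBoundCS_mul {p q : ℝ} (hp : 0 < p) (hq : 0 < q) {lam g : Rd d → ℝ}
    {N : ℝ} (h : OpBoundCS p q (fun _ => 1) lam (fun f x => g x * f x) N) {z : Rd d}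
    {R κ t : ℝ} (hR : 0 < R) (hκ : 0 ≤ κ) (ht : 0 ≤ t)
    (hg : ∀ x ∈ Metric.ball z R, κ ≤ |g x|)
    (hlam : ∀ᵐ x, x ∈ Metric.ball z R → t ≤ lam x) :
    κ * t ^ (1 / q) * (R ^ d * (volume (Metric.ball (0 : Rd d) 1)).toReal) ^ (1 / q - 1 / p) ≤
      max N 0 := by
  have hV0 : volume (Metric.ball z R) ≠ 0 := (Metric.measure_ball_pos _ _ hR).ne'
  have hVt : volume (Metric.ball z R) ≠ ⊤ := measure_ball_lt_top.ne
  set V := volume (Metric.ball z R) with hV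
  have h1 := h _ (bddCompactSupp_indicator_ball z R)
  rw [wnorm_one hp, wnorm_eq hq] at h1
  have hr : (∫⁻ x, ‖(Metric.ball z R).indicator (fun _ => (1 : ℝ)) x‖ₑ ^ p) = V := by
    refine Eq.trans ?_ (lintegral_indicator_one measurableSet_ball)
    congr 1
    ext x
    by_cases hx : x ∈ Metric.ball z R <;> simp [hx, hp]
  have hl : (ENNReal.ofReal κ * ENNReal.ofReal t ^ (1 / q)) ^ q * V ≤
      ∫⁻ x, (‖g x * (Metric.ball z R).indicator (fun _ => (1 : ℝ)) x‖ₑ *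
        ENNReal.ofReal (lam x) ^ (1 / q)) ^ q := by
    rw [← lintegral_indicator_const (measurableSet_ball (x := z) (ε := R))]
    refine lintegral_mono_ae ?_
    filter_upwards [hlam] with x hx
    by_cases hxb : x ∈ Metric.ball z R
    · rw [Set.indicator_of_mem hxb, Set.indicator_of_mem hxb, mul_one, Real.enorm_eq_ofReal_abs]
      gcongr
      · exact hg x hxb
      · exact hx hxb
    · simp [hxb]
  rw [hr] at h1
  have h2 := (ENNReal.rpow_le_rpow hl (by positivity : (0 : ℝ) ≤ 1 / q)).trans h1
  rw [ENNReal.mul_rpow_of_nonneg _ _ (by positivity), ← ENNReal.rpow_mul,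
    mul_one_div_cancel hq.ne', ENNReal.rpow_one] at h2
  have h3 : ENNReal.ofReal κ * ENNReal.ofReal t ^ (1 / q) * V ^ (1 / q - 1 / p) ≤
      ENNReal.ofReal N := by
    rw [ENNReal.rpow_sub _ _ hV0 hVt, ← mul_div_assoc]
    exact ENNReal.div_le_of_le_mul h2
  have h4 := ENNReal.toReal_mono ENNReal.ofReal_ne_top h3
  rwa [ENNReal.toReal_mul, ENNReal.toReal_mul, ← ENNReal.toReal_rpow, ← ENNReal.toReal_rpow,
    ENNReal.toReal_ofReal hκ, ENNReal.toReal_ofReal ht, ENNReal.toReal_ofReal', hV,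
    Measure.addHaar_ball_of_pos _ _ hR, finrank_euclideanSpace, Fintype.card_fin,
    ENNReal.toReal_mul, ENNReal.toReal_ofReal (by positivity)] at h4

lemma not_opBoundCS_cutoff_sub_one (hd : 0 < d) {p q : ℝ} (hq : 0 < q) (hqp : q < p)
    {lam : Rd d → ℝ} (hlam : ∀ x, 1 ≤ lam x) (N : ℝ) :
    ¬ OpBoundCS p q (fun _ => 1) lam (fun f x => (cutoff x - 1) * f x) N := by
  intro h
  have : Nonempty (Fin d) := ⟨⟨0, hd⟩⟩
  have hs : 0 < 1 / q - 1 / p := sub_pos.2 (one_div_lt_one_div_of_lt hq hqp)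
  set v := (volume (Metric.ball (0 : Rd d) 1)).toReal
  have hv : 0 < v := ENNReal.toReal_pos (Metric.measure_ball_pos _ _ one_pos).ne'
    measure_ball_lt_top.ne
  have hbound : ∀ R : ℝ, 0 < R → (R ^ d * v) ^ (1 / q - 1 / p) ≤ max N 0 := by
    intro R hR
    obtain ⟨z, hz⟩ := exists_norm_eq (Rd d) (by linarith : 0 ≤ R + 2)
    have := mul_rpow_le_of_opBoundCS_mul (hq.trans hqp) hq h (z := z) hR zero_le_one zero_le_one
      (fun x hx => ?_) (.of_forall fun x _ => hlam x)
    · simpa using this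
    · rw [Metric.mem_ball, dist_eq_norm, norm_sub_rev] at hx
      have := norm_sub_norm_le z x
      rw [cutoff_of_two_le_norm (by linarith)]
      simp
  have hlim : Tendsto (fun R : ℝ => (R ^ d * v) ^ (1 / q - 1 / p)) atTop atTop :=
    (tendsto_rpow_atTop hs).comp ((tendsto_pow_atTop hd.ne').atTop_mul_const hv)
  obtain ⟨R, hR, hR'⟩ := ((hlim.eventually_gt_atTop (max N 0)).and (eventually_gt_atTop 0)).exists
  exact (hbound R hR').not_gt hR

lemma not_opBoundCS_cutoff_sub (hd : 0 < d) {p q α : ℝ} (hq : 0 < q) (hqp : q < p) (hα0 : 0 ≤ α)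
    (hα : d * (1 - q / p) < α) {c : ℝ} (hc : c ≠ 1) (N : ℝ) :
    ¬ OpBoundCS p q (fun _ : Rd d => 1) (singWeight α) (fun f x => (cutoff x - c) * f x) N := by
  intro h
  have : Nonempty (Fin d) := ⟨⟨0, hd⟩⟩
  have hp : 0 < p := hq.trans hqp
  set v := (volume (Metric.ball (0 : Rd d) 1)).toReal
  have hv : 0 < v := ENNReal.toReal_pos (Metric.measure_ball_pos _ _ one_pos).ne'
    measure_ball_lt_top.ne
  set s := 1 / q - 1 / p
  set κ := |1 - c|
  have hκ : 0 < κ := abs_pos.2 (sub_ne_zero.2 hc.symm)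
  have hexp : 0 < α / q - d * s := by
    have : d * s = d * (1 - q / p) / q := by
      simp only [s]
      field_simp
    rw [this, ← sub_div]
    exact div_pos (by linarith) hq
  have hbound : ∀ R : ℝ, 1 < R → κ * v ^ s * R ^ (α / q - d * s) ≤ max N 0 := by
    intro R hR
    have hR0 : 0 < R := by linarith
    have := mul_rpow_le_of_opBoundCS_mul hp hq h (z := 0) (t := R ^ α) (inv_pos.2 hR0) hκ.le
      (by positivity) (fun x hx => ?_) ?_
    · refine le_of_eq_of_le ?_ this
      rw [Real.mul_rpow (by positivity) hv.le, ← Real.rpow_natCast, ← Real.rpow_mul (by positivity),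
        Real.inv_rpow hR0.le, Real.inv_rpow (by positivity), ← Real.rpow_mul hR0.le, mul_one_div,
        Real.rpow_sub hR0]
      ring
    · rw [mem_ball_zero_iff] at hx
      rw [cutoff_of_norm_le_one (hx.le.trans (inv_le_one_of_one_le₀ hR.le))]
    · filter_upwards [Measure.ae_ne volume (0 : Rd d)] with x hx0 hx
      rw [mem_ball_zero_iff] at hx
      have hx0' : 0 < ‖x‖ := norm_pos_iff.2 hx0
      rw [singWeight, Real.rpow_neg hx0'.le, ← Real.inv_rpow hx0'.le]
      have : R ^ α ≤ ‖x‖⁻¹ ^ α := by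
        gcongr
        exact ((lt_inv_comm₀ hx0' hR0).1 hx).le
      linarith
  have hlim : Tendsto (fun R : ℝ => κ * v ^ s * R ^ (α / q - d * s)) atTop atTop :=
    (tendsto_rpow_atTop hexp).const_mul_atTop (by positivity)
  obtain ⟨R, hR, hR'⟩ := ((hlim.eventually_gt_atTop (max N 0)).and (eventually_gt_atTop 1)).exists
  exact (hbound R hR').not_gt hR

/-- **Theorem 5.3** (the multiplier condition is sufficient but in general not necessary
for the boundedness of the commutator). Let `T` be a Dini-continuous Calderón–Zygmund
operator. (i) For all `1 < p, q < ∞`, `μ ∈ A_p`, `λ ∈ A_q` and `b ∈ L¹_loc`,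
`‖[b,T]‖_{L^p(μ)→L^q(λ)} ≤ (‖T‖_{L^p(μ)→L^p(μ)} + ‖T‖_{L^q(λ)→L^q(λ)}) ·
inf_c ‖f ↦ (b−c)f‖_{L^p(μ)→L^q(λ)}`. (ii) For every `1 < q < p < ∞` there are `μ ∈ A_p`,
`λ ∈ A_q` and `b ∈ L¹_loc` such that the multiplication operators `f ↦ (b−c)f` are all
unbounded from `L^p(μ)` to `L^q(λ)` while `[b,T] : L^p(μ) → L^q(λ)` is bounded. -/
theorem stmt18 (d : ℕ) (hd : 0 < d) (ω : ℝ → ℝ) (hω : ModulusOfContinuity ω)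
    (hDini : DiniCondition ω) (T : CZOperator d ω) :
    (∀ p q : ℝ, 1 < p → 1 < q →
      ∀ μ lam : Rd d → ℝ, IsApOn Set.univ p μ → IsApOn Set.univ q lam →
        ∀ b : Rd d → ℝ, L1loc b →
          ∀ Np Nq : ℝ, 0 ≤ Np → 0 ≤ Nq →
            OpBound p p μ μ T.T Np → OpBound q q lam lam T.T Nq →
            ∀ c Nc : ℝ, 0 ≤ Nc →
              OpBound p q μ lam (fun f x => (b x - c) * f x) Nc →
              OpBound p q μ lam (commutatorOp b T.T) ((Np + Nq) * Nc)) ∧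
    (∀ p q : ℝ, 1 < q → q < p →
      ∃ μ lam b : Rd d → ℝ, IsApOn Set.univ p μ ∧ IsApOn Set.univ q lam ∧ L1loc b ∧
        (∀ c N : ℝ, ¬ OpBoundCS p q μ lam (fun f x => (b x - c) * f x) N) ∧
        (∃ N : ℝ, 0 ≤ N ∧ OpBoundCS p q μ lam (commutatorOp b T.T) N)) := by
  refine ⟨fun p q hp hq μ lam _ hlam b hb Np Nq hNp hNq hTp hTq c Nc hNc hbc =>
    opBound_commutatorOp T hq hlam.1 hb.1 hNp hNq hTp hTq hbc, fun p q hq hqp => ?_⟩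
  have hq0 : 0 < q := by linarith
  have hp0 : 0 < p := by linarith
  have hd0 : (0 : ℝ) < d := by exact_mod_cast hd
  have hqp1 : q / p < 1 := (div_lt_one hp0).2 hqp
  have hqp0 : 0 < q / p := div_pos hq0 hp0
  set α : ℝ := d * (1 - q / p / 2)
  have hα0 : 0 ≤ α := mul_nonneg hd0.le (by linarith)
  have hα : α < d := mul_lt_of_lt_one_right hd0 (by linarith)
  have hα' : d * (1 - q / p) < α := mul_lt_mul_of_pos_left (by linarith) hd0
  refine ⟨fun _ => 1, singWeight α, cutoff, isApOn_one (hq.trans hqp),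
    isApOn_singWeight hd hα0 hα hq,
    ⟨measurable_cutoff, lipschitzWith_cutoff.continuous.locallyIntegrable⟩, fun c N => ?_,
    exists_opBoundCS_commutatorOp_cutoff hd hω T hα0 hα hq hqp.le⟩
  by_cases hc : c = 1
  · rw [hc]
    exact not_opBoundCS_cutoff_sub_one hd hq0 hqp (one_le_singWeight α) N
  · exact not_opBoundCS_cutoff_sub hd hq0 hqp hα0 hα' hc N
end
end

section
/- Let r ∈ (1,∞) and b := 1_{B(0,1)} the indicator of the closed unit ball in ℝ^d. (i) If ν(x) := |x|^γ with γ ≥ 0, then ‖M_ν^# b‖_{L^r(ν)} < ∞. (ii) If ν(x) := |x|^{d(r'−1)}, then inf_c ‖(b − c) ν^{−1}‖_{L^r(ν)} = ∞, where the infimum is over constants c. -/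
open MeasureTheory ENNReal Set Filter

noncomputable section

variable {d : ℕ}

namespace Cube

lemma carrier_eq_preimage (Q : Cube d) :
    Q.carrier = WithLp.ofLp ⁻¹'
      (univ.pi fun i => Ico (Q.corner i) (Q.corner i + Q.side)) := by
  ext x
  simp [carrier]

lemma measurableSet_carrier_s19 (Q : Cube d) : MeasurableSet Q.carrier := by
  rw [carrier_eq_preimage]
  exact (PiLp.volume_preserving_ofLp (Fin d)).measurable
    (MeasurableSet.univ_pi fun _ => measurableSet_Ico)

lemma volume_carrier_s19 (Q : Cube d) : volume Q.carrier = ENNReal.ofReal Q.vol := by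
  rw [carrier_eq_preimage, (PiLp.volume_preserving_ofLp (Fin d)).measure_preimage
    (MeasurableSet.univ_pi fun _ => measurableSet_Ico).nullMeasurableSet, Real.volume_pi_Ico]
  simp [vol, ENNReal.ofReal_pow Q.side_pos.le]

lemma vol_pos_s19 (Q : Cube d) : 0 < Q.vol := pow_pos Q.side_pos d

lemma volume_real_carrier_s19 (Q : Cube d) : volume.real Q.carrier = Q.vol := by
  rw [measureReal_def, volume_carrier_s19, ENNReal.toReal_ofReal Q.vol_pos_s19.le]

lemma volume_carrier_ne_top (Q : Cube d) : volume Q.carrier ≠ ⊤ := by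
  simp [volume_carrier_s19]

lemma norm_sub_le (Q : Cube d) {x z : Rd d} (hx : x ∈ Q.carrier) (hz : z ∈ Q.carrier) :
    ‖x - z‖ ≤ d * Q.side := by
  have hs := Q.side_pos
  refine le_of_sq_le_sq ?_ (by positivity)
  rw [EuclideanSpace.real_norm_sq_eq]
  calc ∑ i, (x - z) i ^ 2 ≤ ∑ _i : Fin d, Q.side ^ 2 := by
        refine Finset.sum_le_sum fun i _ => ?_
        have h1 := hx i
        have h2 := hz i
        rw [PiLp.sub_apply]
        exact sq_le_sq' (by linarith) (by linarith)
    _ = d * Q.side ^ 2 := by simp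
    _ ≤ (d : ℝ) ^ 2 * Q.side ^ 2 := by
        gcongr
        exact_mod_cast Nat.le_self_pow two_ne_zero d
    _ = (d * Q.side) ^ 2 := by ring

/-- The subcube of a quarter of the side length which lies farthest from the origin. -/
def farQuarter (Q : Cube d) : Cube d where
  corner i := if 0 ≤ Q.corner i + Q.side / 2 then Q.corner i + 3 / 4 * Q.side else Q.corner i
  side := Q.side / 4
  side_pos := by have := Q.side_pos; positivity

lemma farQuarter_subset (Q : Cube d) : Q.farQuarter.carrier ⊆ Q.carrier := by
  intro x hx i
  have h := hx i
  have hs := Q.side_pos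
  simp only [farQuarter] at h
  split_ifs at h <;> constructor <;> linarith [h.1, h.2]

lemma norm_le_of_mem_farQuarter (Q : Cube d) {x y : Rd d} (hx : x ∈ Q.farQuarter.carrier)
    (hy : y ∈ Q.carrier) : ‖y‖ / 2 ≤ ‖x‖ := by
  refine le_of_sq_le_sq ?_ (norm_nonneg x)
  rw [div_pow, EuclideanSpace.real_norm_sq_eq, EuclideanSpace.real_norm_sq_eq, Finset.sum_div]
  refine Finset.sum_le_sum fun i _ => ?_
  have h := hx i
  have h' := hy i
  have hs := Q.side_pos
  simp only [farQuarter] at h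
  rw [← div_pow]
  refine sq_le_sq.2 ?_
  split_ifs at h with h0
  · rw [abs_of_nonneg (a := x i) (by linarith [h.1])]
    exact abs_le.2 ⟨by linarith [h.1], by linarith [h.1]⟩
  · rw [abs_of_nonpos (a := x i) (by linarith [h.2])]
    exact abs_le.2 ⟨by linarith [h.2], by linarith [h.2]⟩

end Cube

lemma integrableOn_norm_rpow (Q : Cube d) {γ : ℝ} (hγ : 0 ≤ γ) :
    IntegrableOn (fun x : Rd d => ‖x‖ ^ γ) Q.carrier := by
  rcases Q.carrier.eq_empty_or_nonempty with h | ⟨z, hz⟩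
  · simp [h]
  have hc : Continuous fun x : Rd d => ‖x‖ ^ γ := continuous_norm.rpow_const fun _ => Or.inr hγ
  refine (hc.locallyIntegrable.integrableOn_isCompact
    (isCompact_closedBall z (d * Q.side))).mono_set fun x hx => ?_
  rw [Metric.mem_closedBall, dist_eq_norm]
  exact Q.norm_sub_le hx hz

lemma le_wInt_norm_rpow (Q : Cube d) {γ : ℝ} (hγ : 0 ≤ γ) {y : Rd d} (hy : y ∈ Q.carrier) :
    (Q.side / 4) ^ d * (‖y‖ / 2) ^ γ ≤ wInt Q fun x : Rd d => ‖x‖ ^ γ := by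
  calc (Q.side / 4) ^ d * (‖y‖ / 2) ^ γ
      = ∫ _x in Q.farQuarter.carrier, (‖y‖ / 2) ^ γ := by
        rw [setIntegral_const, Cube.volume_real_carrier_s19, smul_eq_mul]; rfl
    _ ≤ ∫ x in Q.farQuarter.carrier, ‖x‖ ^ γ := by
        refine setIntegral_mono_on
          (integrableOn_const Q.farQuarter.volume_carrier_ne_top)
          (integrableOn_norm_rpow _ hγ) Q.farQuarter.measurableSet_carrier_s19 fun x hx => ?_
        exact Real.rpow_le_rpow (by positivity) (Q.norm_le_of_mem_farQuarter hx hy) hγ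
    _ ≤ ∫ x in Q.carrier, ‖x‖ ^ γ :=
        setIntegral_mono_set (integrableOn_norm_rpow Q hγ)
          (Eventually.of_forall fun x => by positivity) Q.farQuarter_subset.eventuallyLE

lemma osc_eq_zero_of_const {Q : Cube d} {b : Rd d → ℝ} {a : ℝ}
    (h : ∀ x ∈ Q.carrier, b x = a) : osc Q b = 0 := by
  have havg : avg Q b = a := by
    rw [avg, intC, setIntegral_congr_fun Q.measurableSet_carrier_s19 h, setIntegral_const,
      Q.volume_real_carrier_s19, smul_eq_mul, inv_mul_cancel_left₀ Q.vol_pos_s19.ne']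
  rw [osc, setIntegral_congr_fun (g := fun _ => 0) Q.measurableSet_carrier_s19]
  · simp
  · intro x hx
    simp [havg, h x hx]

lemma osc_le_two_mul {Q : Cube d} {b : Rd d → ℝ} (hb : ∀ x, 0 ≤ b x)
    (hint : IntegrableOn b Q.carrier) : osc Q b ≤ 2 * intC Q b := by
  have hI : 0 ≤ intC Q b := integral_nonneg hb
  have hav : 0 ≤ avg Q b := mul_nonneg (inv_nonneg.2 Q.vol_pos_s19.le) hI
  have hc : IntegrableOn (fun _ : Rd d => avg Q b) Q.carrier :=
    integrableOn_const Q.volume_carrier_ne_top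
  calc osc Q b ≤ ∫ x in Q.carrier, (b x + avg Q b) := by
        refine integral_mono (hint.sub hc).abs (hint.add hc) fun x => ?_
        exact abs_le.2 ⟨by linarith [hb x], by linarith [hb x]⟩
    _ = 2 * intC Q b := by
        rw [integral_add hint hc, setIntegral_const, Q.volume_real_carrier_s19, smul_eq_mul, avg,
          mul_inv_cancel_left₀ Q.vol_pos_s19.ne', intC]
        ring

/-- The indicator of the closed unit ball. -/
abbrev unitBallInd (d : ℕ) : Rd d → ℝ := (Metric.closedBall (0 : Rd d) 1).indicator fun _ => 1

lemma integrable_unitBallInd : Integrable (unitBallInd d) :=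
  (integrable_indicator_iff measurableSet_closedBall).2
    (integrableOn_const measure_closedBall_lt_top.ne)

lemma unitBallInd_nonneg (x : Rd d) : 0 ≤ unitBallInd d x :=
  indicator_nonneg (fun _ _ => zero_le_one) x

lemma osc_unitBallInd_le_vol (Q : Cube d) : osc Q (unitBallInd d) ≤ 2 * Q.vol := by
  refine (osc_le_two_mul unitBallInd_nonneg integrable_unitBallInd.integrableOn).trans ?_
  gcongr
  calc intC Q (unitBallInd d) ≤ ∫ _x in Q.carrier, (1 : ℝ) := by
        refine integral_mono integrable_unitBallInd.integrableOn
          (integrableOn_const Q.volume_carrier_ne_top) fun x => ?_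
        exact indicator_le_self' (fun _ _ => zero_le_one) x
    _ = Q.vol := by rw [setIntegral_const, Q.volume_real_carrier_s19, smul_eq_mul, mul_one]

lemma osc_unitBallInd_le_ball (Q : Cube d) :
    osc Q (unitBallInd d) ≤ 2 * volume.real (Metric.closedBall (0 : Rd d) 1) := by
  refine (osc_le_two_mul unitBallInd_nonneg integrable_unitBallInd.integrableOn).trans ?_
  gcongr
  calc intC Q (unitBallInd d) ≤ ∫ x, unitBallInd d x :=
        setIntegral_le_integral integrable_unitBallInd (Eventually.of_forall unitBallInd_nonneg)
    _ = volume.real (Metric.closedBall (0 : Rd d) 1) := by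
        simp [unitBallInd, integral_indicator measurableSet_closedBall]

/-- The oscillation of the indicator of the unit ball vanishes on cubes not meeting both the ball
and its complement. -/
lemma exists_of_osc_ne_zero {Q : Cube d} (h : osc Q (unitBallInd d) ≠ 0) :
    (∃ y ∈ Q.carrier, 1 ≤ ‖y‖) ∧ ∃ z ∈ Q.carrier, ‖z‖ ≤ 1 := by
  constructor
  · by_contra! hc
    exact h (osc_eq_zero_of_const (a := 1) fun x hx =>
      indicator_of_mem (by simpa using (hc x hx).le) _)
  · by_contra! hc
    exact h (osc_eq_zero_of_const (a := 0) fun x hx =>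
      indicator_of_notMem (by simpa using hc x hx) _)

lemma exists_osc_div_wInt_le {γ : ℝ} (hγ : 0 ≤ γ) :
    ∃ K : ℝ, 0 ≤ K ∧ ∀ (Q : Cube d) (x : Rd d), x ∈ Q.carrier →
      osc Q (unitBallInd d) / wInt Q (fun x : Rd d => ‖x‖ ^ γ) ≤
        K * (1 + ‖x‖) ^ (-(d + γ)) := by
  set V := volume.real (Metric.closedBall (0 : Rd d) 1) with hV
  set A : ℝ := 2 ^ (d - 1) * (2 ^ d * 2 + d ^ d * (2 * V)) with hA
  have hV0 : 0 ≤ V := measureReal_nonneg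
  refine ⟨A * 4 ^ d * 4 ^ γ, by positivity, fun Q x hx => ?_⟩
  by_cases h0 : osc Q (unitBallInd d) = 0
  · rw [h0, zero_div]; positivity
  obtain ⟨⟨y, hy, hy1⟩, z, hz, hz1⟩ := exists_of_osc_ne_zero h0
  have hs := Q.side_pos
  have hn : 0 < 1 + ‖x‖ := by positivity
  have hosc0 : 0 ≤ osc Q (unitBallInd d) := integral_nonneg fun _ => abs_nonneg _
  have hx1 : 1 + ‖x‖ ≤ 2 + d * Q.side := by
    have h1 := Q.norm_sub_le hx hz
    have h2 := norm_le_norm_add_norm_sub' x z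
    linarith
  have hup : osc Q (unitBallInd d) * (1 + ‖x‖) ^ d ≤ A * Q.side ^ d := by
    calc osc Q (unitBallInd d) * (1 + ‖x‖) ^ d
        ≤ osc Q (unitBallInd d) * (2 ^ (d - 1) * (2 ^ d + (d * Q.side) ^ d)) := by
          gcongr
          exact (pow_le_pow_left₀ hn.le hx1 d).trans (add_pow_le (by norm_num) (by positivity) d)
      _ = 2 ^ (d - 1) * (2 ^ d * osc Q (unitBallInd d) +
            d ^ d * Q.side ^ d * osc Q (unitBallInd d)) := by ring
      _ ≤ 2 ^ (d - 1) * (2 ^ d * (2 * Q.vol) + d ^ d * Q.side ^ d * (2 * V)) := by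
          gcongr
          · exact osc_unitBallInd_le_vol Q
          · exact osc_unitBallInd_le_ball Q
      _ = A * Q.side ^ d := by rw [hA, Cube.vol]; ring
  have hlow : (Q.side / 4) ^ d * ((1 + ‖x‖) / 4) ^ γ ≤ wInt Q fun x : Rd d => ‖x‖ ^ γ := by
    obtain ⟨w, hw, hw1⟩ : ∃ w ∈ Q.carrier, 1 + ‖x‖ ≤ 2 * ‖w‖ := by
      rcases le_total ‖x‖ 1 with h | h
      · exact ⟨y, hy, by linarith⟩
      · exact ⟨x, hx, by linarith⟩
    refine le_trans ?_ (le_wInt_norm_rpow Q hγ hw)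
    exact mul_le_mul_of_nonneg_left
      (Real.rpow_le_rpow (by positivity) (by linarith) hγ) (by positivity)
  calc osc Q (unitBallInd d) / wInt Q (fun x : Rd d => ‖x‖ ^ γ)
      ≤ (A * Q.side ^ d / (1 + ‖x‖) ^ d) / ((Q.side / 4) ^ d * ((1 + ‖x‖) / 4) ^ γ) := by
        gcongr
        rwa [le_div_iff₀ (by positivity)]
    _ = A * 4 ^ d * 4 ^ γ * (1 + ‖x‖) ^ (-(d + γ)) := by
        rw [Real.rpow_neg hn.le, Real.rpow_add hn, Real.rpow_natCast, div_pow Q.side,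
          Real.div_rpow hn.le (by norm_num)]
        have : (0 : ℝ) < 4 ^ γ := by positivity
        have : 0 < (1 + ‖x‖) ^ γ := by positivity
        field_simp

lemma sharpNormOn_unitBallInd_lt_top {r γ : ℝ} (hd : 0 < d) (hr : 1 < r) (hγ : 0 ≤ γ) :
    sharpNormOn Set.univ r (fun x : Rd d => ‖x‖ ^ γ) (unitBallInd d) < ⊤ := by
  obtain ⟨K, hK, hbound⟩ := exists_osc_div_wInt_le (d := d) hγ
  have hd' : (0 : ℝ) < d := by exact_mod_cast hd
  have hr0 : 0 < r := by linarith
  refine ENNReal.rpow_lt_top_of_nonneg (by positivity) (ne_of_lt ?_)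
  calc ∫⁻ x : Rd d, sharpMaxOn Set.univ (fun x : Rd d => ‖x‖ ^ γ) (unitBallInd d) x ^ r *
          ENNReal.ofReal (‖x‖ ^ γ)
      ≤ ∫⁻ x : Rd d, ENNReal.ofReal (K ^ r) *
          ENNReal.ofReal ((1 + ‖x‖) ^ (-((d + γ) * r - γ))) := by
        refine lintegral_mono fun x => ?_
        have hn : 0 < 1 + ‖x‖ := by positivity
        have hsup : sharpMaxOn Set.univ (fun x : Rd d => ‖x‖ ^ γ) (unitBallInd d) x ≤
            ENNReal.ofReal (K * (1 + ‖x‖) ^ (-(d + γ))) :=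
          iSup_le fun Q => iSup_le fun _ => iSup_le fun hx =>
            ENNReal.ofReal_le_ofReal (hbound Q x hx)
        calc _ ≤ ENNReal.ofReal (K * (1 + ‖x‖) ^ (-(d + γ))) ^ r *
              ENNReal.ofReal ((1 + ‖x‖) ^ γ) := by
              gcongr
              linarith
          _ = _ := by
              rw [ENNReal.ofReal_rpow_of_nonneg (by positivity) hr0.le,
                Real.mul_rpow hK (by positivity), ← Real.rpow_mul hn.le,
                ENNReal.ofReal_mul (by positivity), mul_assoc,
                ← ENNReal.ofReal_mul (by positivity), ← Real.rpow_add hn]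
              congr 3
              ring
    _ < ⊤ := by
        rw [lintegral_const_mul' _ _ ENNReal.ofReal_ne_top]
        refine ENNReal.mul_lt_top ENNReal.ofReal_lt_top (finite_integral_one_add_norm ?_)
        rw [finrank_euclideanSpace_fin]
        nlinarith [mul_pos hd' (sub_pos.2 hr), mul_nonneg hγ (sub_pos.2 hr).le]

/-- Radial functions comparable to `|x|^{-d}` near the origin or near infinity are not
integrable. -/
lemma not_integrable_radial (hd : 0 < d) {f : ℝ → ℝ} {a : ℝ} (ha : a ≠ 0)
    (h : (∀ t, 0 < t → t ≤ 1 → f t = a * (t ^ d)⁻¹) ∨ ∀ t, 1 < t → f t = a * (t ^ d)⁻¹) :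
    ¬ Integrable fun x : Rd d => f ‖x‖ := by
  have : Nonempty (Fin d) := ⟨⟨0, hd⟩⟩
  have : Nontrivial (Rd d) := inferInstance
  rw [integrable_fun_norm_addHaar, finrank_euclideanSpace_fin]
  intro hint
  have key : ∀ t : ℝ, 0 < t → f t = a * (t ^ d)⁻¹ → a⁻¹ * (t ^ (d - 1) • f t) = t⁻¹ := by
    intro t ht hf
    obtain ⟨n, rfl⟩ : ∃ n, d = n + 1 := ⟨d - 1, by omega⟩
    rw [hf, smul_eq_mul, Nat.add_sub_cancel, pow_succ]
    field_simp
  have hint' := hint.const_mul a⁻¹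
  rcases h with h | h
  · have h1 : IntegrableOn (fun t : ℝ => t⁻¹) (Ioc 0 1) :=
      IntegrableOn.congr_fun (IntegrableOn.mono_set hint' Ioc_subset_Ioi_self)
        (fun t ht => key t ht.1 (h t ht.1 ht.2)) measurableSet_Ioc
    rw [← intervalIntegrable_iff_integrableOn_Ioc_of_le zero_le_one, intervalIntegrable_inv_iff]
      at h1
    simp at h1
  · exact not_integrableOn_Ioi_inv (a := 1) (IntegrableOn.congr_fun
      (IntegrableOn.mono_set hint' (Ioi_subset_Ioi zero_le_one))
      (fun t ht => key t (zero_lt_one.trans ht) (h t ht)) measurableSet_Ioi)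

lemma wnorm_unitBallInd_sub_const (hd : 0 < d) {r : ℝ} (hr : 1 < r) (c : ℝ) :
    wnorm r (fun x : Rd d => ‖x‖ ^ (d * (conj r - 1)))
      (fun x : Rd d => (unitBallInd d x - c) * (‖x‖ ^ (d * (conj r - 1)))⁻¹) = ⊤ := by
  set s : ℝ := d * (conj r - 1) with hs
  have hsr : s * (r - 1) = d := by
    have : r - 1 ≠ 0 := by linarith
    rw [hs, conj]
    field_simp
    ring
  set f : ℝ → ℝ := fun t =>
    |((Iic (1 : ℝ)).indicator (fun _ => (1 : ℝ)) t - c) * (t ^ s)⁻¹| ^ r * t ^ s with hf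
  have hfx : ∀ x : Rd d,
      |(unitBallInd d x - c) * (‖x‖ ^ s)⁻¹| ^ r * ‖x‖ ^ s = f ‖x‖ := by
    intro x
    have hx : unitBallInd d x = (Iic (1 : ℝ)).indicator (fun _ => (1 : ℝ)) ‖x‖ := by
      have hpre : Metric.closedBall (0 : Rd d) 1 = norm ⁻¹' Iic (1 : ℝ) := by ext; simp
      rw [unitBallInd, hpre]
      rfl
    rw [hx]
  have hmeas : Measurable f := by
    have : Measurable ((Iic (1 : ℝ)).indicator fun _ => (1 : ℝ)) :=
      measurable_const.indicator measurableSet_Iic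
    fun_prop
  have hval : ∀ (t : ℝ) (e : ℝ), 0 < t →
      |(e - c) * (t ^ s)⁻¹| ^ r * t ^ s = |e - c| ^ r * (t ^ d)⁻¹ := by
    intro t e ht
    rw [abs_mul, abs_of_pos (a := (t ^ s)⁻¹) (by positivity),
      Real.mul_rpow (abs_nonneg _) (by positivity), mul_assoc, ← Real.rpow_neg ht.le,
      ← Real.rpow_mul ht.le, ← Real.rpow_add ht, ← Real.rpow_natCast t d,
      ← Real.rpow_neg ht.le]
    congr 2
    linear_combination -hsr
  have hni : ¬ Integrable fun x : Rd d => f ‖x‖ := by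
    by_cases hc : c = 1
    · refine not_integrable_radial hd (a := |0 - c| ^ r) (by simp [hc]) (Or.inr fun t ht => ?_)
      rw [← hval t 0 (by linarith), hf]
      simp [ht]
    · refine not_integrable_radial hd (a := |1 - c| ^ r) ?_ (Or.inl fun t ht ht1 => ?_)
      · exact (Real.rpow_pos_of_pos (abs_pos.2 (sub_ne_zero.2 (Ne.symm hc))) r).ne'
      · rw [← hval t 1 ht, hf]
        simp [ht1]
  have htop : ∫⁻ x : Rd d, ENNReal.ofReal (f ‖x‖) = ⊤ := by
    by_contra hne
    refine hni ⟨(hmeas.comp measurable_norm).aestronglyMeasurable, ?_⟩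
    rw [hasFiniteIntegral_iff_ofReal (Eventually.of_forall fun x => by
      simp only [Pi.zero_apply, hf]; positivity)]
    exact lt_top_iff_ne_top.2 hne
  rw [wnorm]
  simp only [hfx]
  rw [htop, ENNReal.top_rpow_of_pos (by positivity)]

/-- **Lemma 5.4** (key example: `b = 1_{B(0,1)}`). (i) For the power weight
`ν(x) = |x|^γ` with `γ ≥ 0` one has `‖M_ν^♯ b‖_{L^r(ν)} < ∞`. (ii) For
`ν(x) = |x|^{d(r'−1)}` one has `inf_c ‖(b−c)ν^{−1}‖_{L^r(ν)} = ∞`. -/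
theorem stmt19 (d : ℕ) (hd : 0 < d) (r : ℝ) (hr : 1 < r) :
    (∀ γ : ℝ, 0 ≤ γ →
      sharpNormOn Set.univ r (fun x : Rd d => ‖x‖ ^ γ)
        ((Metric.closedBall (0 : Rd d) 1).indicator fun _ => 1) < ⊤) ∧
    (∀ c : ℝ,
      wnorm r (fun x : Rd d => ‖x‖ ^ (d * (conj r - 1)))
        (fun x : Rd d =>
          ((Metric.closedBall (0 : Rd d) 1).indicator (fun _ => (1 : ℝ)) x - c) *
            (‖x‖ ^ (d * (conj r - 1)))⁻¹) = ⊤) := by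
  exact ⟨fun γ hγ => sharpNormOn_unitBallInd_lt_top hd hr hγ,
    fun c => wnorm_unitBallInd_sub_const hd hr c⟩
end
end
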